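/- arXiv:2601.04182 — 4 statements merged into one kernel-verified Lean document; each statement's English description precedes it below -/
import Mathlib

section
/- For all n ≥ 4, let v = s_{n-3} = (n−2, n−3) be the simple transposition in S_n, let u = (2,3,…,n−2,1,n,n−1) ∈ S_n and w = (2,3,…,n−1,1,n,n−2) ∈ S_n (in one-line notation), with bit scaling taken with respect to k = n−1. Then c^w_{u,v} = 1 and c^{N⊗w}_{N⊗u, N⊗v} = 0 for all N > 1. -/
open scoped Classical

/-- `w` lies in (the copy of) `S_n`: it fixes every point `m ≥ n` (0-indexed). -/
def InSymm (n : ℕ) (w : Equiv.Perm ℕ) : Prop := ∀ m, n ≤ m → w m = m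

/-- `w ∈ S_∞`: `w` fixes all but finitely many points. -/
def IsFinPerm (w : Equiv.Perm ℕ) : Prop := ∃ n, InSymm n w

/-- `ℓ(w)`: the number of inversions of `w`. -/
noncomputable def invLen (w : Equiv.Perm ℕ) : ℕ :=
  Set.ncard {p : ℕ × ℕ | p.1 < p.2 ∧ w p.2 < w p.1}

/-- the Lehmer code of `w` (0-indexed): `lCode w i = #{j > i | w j < w i}`. -/
noncomputable def lCode (w : Equiv.Perm ℕ) (i : ℕ) : ℕ :=
  Set.ncard {j | i < j ∧ w j < w i}

/-- the descent set of `w` (0-indexed). -/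
def des (w : Equiv.Perm ℕ) : Set ℕ := {i | w (i + 1) < w i}

/-- the divided difference operator `∂ᵢ f = (f - sᵢ·f)/(xᵢ - xᵢ₊₁)`. -/
noncomputable def divDiff (i : ℕ) (f : MvPolynomial ℕ ℤ) : MvPolynomial ℕ ℤ :=
  if h : ∃ g, f - MvPolynomial.rename (Equiv.swap i (i + 1)) f =
      (MvPolynomial.X i - MvPolynomial.X (i + 1)) * g
  then h.choose else 0

/-- `𝔖_{w₀} = x₁^{n-1} x₂^{n-2} ⋯ x_{n-1}` (with variables 0-indexed). -/
noncomputable def staircase (n : ℕ) : MvPolynomial ℕ ℤ :=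
  ∏ i ∈ Finset.range n, (MvPolynomial.X i : MvPolynomial ℕ ℤ) ^ (n - 1 - i)

/-- Fuelled recursion computing Schubert polynomials inside `S_n`:
`𝔖_w = ∂ᵢ 𝔖_{w·sᵢ}` whenever `w i < w (i+1)`, starting from `𝔖_{w₀} = staircase n`. -/
noncomputable def SchubertAux (n : ℕ) : ℕ → Equiv.Perm ℕ → MvPolynomial ℕ ℤ
  | 0, _ => staircase n
  | (k + 1), w =>
    if h : ∃ i, i + 1 < n ∧ w i < w (i + 1) then
      divDiff h.choose (SchubertAux n k (w * Equiv.swap h.choose (h.choose + 1)))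
    else staircase n

/-- the Schubert polynomial `𝔖_w` of `w ∈ S_∞`. -/
noncomputable def Schubert (w : Equiv.Perm ℕ) : MvPolynomial ℕ ℤ :=
  if h : IsFinPerm w then SchubertAux h.choose (h.choose * h.choose) w else 0

/-- `c` is the family of Schubert coefficients `c^w_{u,v}` for the pair `(u,v)`, i.e. the
(finitely supported, `S_∞`-supported) coefficients with
`𝔖_u · 𝔖_v = Σ_{w ∈ S_∞} c^w_{u,v} 𝔖_w`. -/
def IsSchubertCoeff (u v : Equiv.Perm ℕ) (c : Equiv.Perm ℕ →₀ ℕ) : Prop :=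
  (∀ w ∈ c.support, IsFinPerm w) ∧
  Schubert u * Schubert v = c.sum fun w k => (k : MvPolynomial ℕ ℤ) * Schubert w

/-- `w'` is the code scaling `N ∗ w`: the unique permutation whose Lehmer code is
`N` times the Lehmer code of `w`. -/
def IsCodeScale (N : ℕ) (w w' : Equiv.Perm ℕ) : Prop :=
  IsFinPerm w' ∧ ∀ i, lCode w' i = N * lCode w i

/-- the Rothe diagram of `w` (0-indexed). -/
def rothe (w : Equiv.Perm ℕ) : Set (ℕ × ℕ) := {p | p.2 < w p.1 ∧ p.1 < w.symm p.2}

/-- column `h` of the Rothe diagram of `w`. -/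
def rotheCol (w : Equiv.Perm ℕ) (h : ℕ) : Set ℕ := {r | (r, h) ∈ rothe w}

/-- the shaded columns of `D(w)` with respect to `k`: the columns `w r` for rows `r > k`. -/
def shadedCols (k : ℕ) (w : Equiv.Perm ℕ) : Set ℕ := {j | ∃ r, k < r ∧ w r = j}

/-- the position at which (the copies of) column `j` start after every shaded column
is replaced by `N` adjacent copies of itself. -/
noncomputable def stretchCol (k N : ℕ) (w : Equiv.Perm ℕ) (j : ℕ) : ℕ :=
  Set.ncard {h | h < j ∧ h ∉ shadedCols k w} + N * Set.ncard {h | h < j ∧ h ∈ shadedCols k w}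

/-- `w'` is the bit scaling `N ⊗ w` with respect to `k`: the unique permutation in `S_∞`
whose Rothe diagram is obtained from `D(w)` by replacing each shaded column by `N`
adjacent copies of itself. -/
def IsBitScale (k N : ℕ) (w w' : Equiv.Perm ℕ) : Prop :=
  IsFinPerm w' ∧
  rothe w' = {q | ∃ p ∈ rothe w, ∃ m,
    m < (if p.2 ∈ shadedCols k w then N else 1) ∧ q = (p.1, stretchCol k N w p.2 + m)}

/-- `D(u)` together with a copy of `D(v)` shifted `m` columns to the right. -/
def doubleDiagram (m : ℕ) (u v : Equiv.Perm ℕ) : Set (ℕ × ℕ) :=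
  rothe u ∪ {q | ∃ p ∈ rothe v, q = (p.1, p.2 + m)}

/-- `T` is an indicator tableau in `Tab^w_{u,v}` (for `u, v, w ∈ S_m`, all 0-indexed):
a filling of `D(u) ∪ D(v)` with entries in `{0, …, m-1}` such that the number of entries
equal to `i` is `lCode w i`, entries strictly increase down each column, and every entry
appearing in row `r` is at most `r`. -/
def IsIndicatorTableau (m : ℕ) (u v w : Equiv.Perm ℕ) (T : ℕ × ℕ → ℕ) : Prop :=
  (∀ p ∈ doubleDiagram m u v, T p < m) ∧
  (∀ i < m, Set.ncard {p | p ∈ doubleDiagram m u v ∧ T p = i} = lCode w i) ∧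
  (∀ p ∈ doubleDiagram m u v, ∀ q ∈ doubleDiagram m u v, p.2 = q.2 → p.1 < q.1 → T p < T q) ∧
  (∀ p ∈ doubleDiagram m u v, T p ≤ p.1)

namespace SchubertScaling

open MvPolynomial

section DividedDifference

theorem X_sub_X_ne_zero {i j : ℕ} (h : i ≠ j) : (X i - X j : MvPolynomial ℕ ℤ) ≠ 0 :=
  sub_ne_zero.2 fun e => h (X_injective e)

theorem exists_divDiff (i : ℕ) (f : MvPolynomial ℕ ℤ) :
    ∃ g, f - rename (Equiv.swap i (i + 1)) f = (X i - X (i + 1)) * g := by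
  induction f using MvPolynomial.induction_on with
  | C a => exact ⟨0, by simp⟩
  | add p q hp hq =>
    obtain ⟨g, hg⟩ := hp
    obtain ⟨h, hh⟩ := hq
    exact ⟨g + h, by rw [map_add, mul_add, ← hg, ← hh]; ring⟩
  | mul_X p j hp =>
    obtain ⟨g, hg⟩ := hp
    have hX : ∃ h : MvPolynomial ℕ ℤ,
        X j - X (Equiv.swap i (i + 1) j) = (X i - X (i + 1)) * h := by
      rw [Equiv.swap_apply_def]
      split_ifs with h1 h2
      · exact ⟨1, by rw [h1, mul_one]⟩
      · exact ⟨-1, by rw [h2]; ring⟩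
      · exact ⟨0, by simp⟩
    obtain ⟨h, hh⟩ := hX
    refine ⟨g * X j + rename (Equiv.swap i (i + 1)) p * h, ?_⟩
    rw [map_mul, rename_X]
    linear_combination (X j) * hg + rename (Equiv.swap i (i + 1)) p * hh

theorem mul_divDiff (i : ℕ) (f : MvPolynomial ℕ ℤ) :
    (X i - X (i + 1)) * divDiff i f = f - rename (Equiv.swap i (i + 1)) f := by
  rw [divDiff, dif_pos (exists_divDiff i f)]
  exact (exists_divDiff i f).choose_spec.symm

theorem divDiff_eq_of_mul_eq {i : ℕ} {f g : MvPolynomial ℕ ℤ}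
    (h : (X i - X (i + 1)) * g = f - rename (Equiv.swap i (i + 1)) f) : divDiff i f = g :=
  mul_left_cancel₀ (X_sub_X_ne_zero (Nat.succ_ne_self i).symm) ((mul_divDiff i f).trans h.symm)

theorem rename_swap_rename_swap (i j : ℕ) (f : MvPolynomial ℕ ℤ) :
    rename (Equiv.swap i j) (rename (Equiv.swap i j) f) = f := by
  rw [rename_rename]
  have : (Equiv.swap i j ∘ Equiv.swap i j : ℕ → ℕ) = id := by
    ext x
    simp
  rw [this, rename_id_apply]

theorem divDiff_add (i : ℕ) (f g : MvPolynomial ℕ ℤ) :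
    divDiff i (f + g) = divDiff i f + divDiff i g :=
  divDiff_eq_of_mul_eq (by rw [mul_add, mul_divDiff, mul_divDiff, map_add]; ring)

theorem divDiff_mul (i : ℕ) (f g : MvPolynomial ℕ ℤ) :
    divDiff i (f * g) =
      divDiff i f * g + rename (Equiv.swap i (i + 1)) f * divDiff i g := by
  apply divDiff_eq_of_mul_eq
  rw [map_mul]
  linear_combination g * mul_divDiff i f + rename (Equiv.swap i (i + 1)) f * mul_divDiff i g

theorem divDiff_zero (i : ℕ) : divDiff i 0 = 0 :=
  divDiff_eq_of_mul_eq (by simp)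

/-- `divDiff i` as an additive homomorphism. -/
noncomputable def divDiffHom (i : ℕ) : MvPolynomial ℕ ℤ →+ MvPolynomial ℕ ℤ where
  toFun := divDiff i
  map_zero' := divDiff_zero i
  map_add' := divDiff_add i

theorem rename_divDiff (i : ℕ) (f : MvPolynomial ℕ ℤ) :
    rename (Equiv.swap i (i + 1)) (divDiff i f) = divDiff i f := by
  have h := congrArg (rename (Equiv.swap i (i + 1))) (mul_divDiff i f)
  simp only [map_mul, map_sub, rename_X, Equiv.swap_apply_left, Equiv.swap_apply_right,
    rename_swap_rename_swap] at h
  refine (divDiff_eq_of_mul_eq ?_).symm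
  linear_combination -h

theorem divDiff_eq_zero_of_symm {i : ℕ} {f : MvPolynomial ℕ ℤ}
    (h : rename (Equiv.swap i (i + 1)) f = f) : divDiff i f = 0 :=
  divDiff_eq_of_mul_eq (by rw [h]; simp)

theorem divDiff_divDiff (i : ℕ) (f : MvPolynomial ℕ ℤ) : divDiff i (divDiff i f) = 0 :=
  divDiff_eq_zero_of_symm (rename_divDiff i f)

theorem divDiff_comm {i j : ℕ} (h : i + 1 < j) (f : MvPolynomial ℕ ℤ) :
    divDiff i (divDiff j f) = divDiff j (divDiff i f) := by
  have hst : rename (Equiv.swap i (i + 1)) (rename (Equiv.swap j (j + 1)) f) =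
      rename (Equiv.swap j (j + 1)) (rename (Equiv.swap i (i + 1)) f) := by
    rw [rename_rename, rename_rename]
    congr 2
    ext x
    simp only [Function.comp, Equiv.swap_apply_def]
    split_ifs <;> omega
  have hi : ∀ g, rename (Equiv.swap j (j + 1)) ((X i - X (i + 1)) * g : MvPolynomial ℕ ℤ) =
      (X i - X (i + 1)) * rename (Equiv.swap j (j + 1)) g := by
    intro g
    rw [map_mul, map_sub, rename_X, rename_X, Equiv.swap_apply_of_ne_of_ne (by omega) (by omega),
      Equiv.swap_apply_of_ne_of_ne (by omega) (by omega)]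
  have hj : ∀ g, rename (Equiv.swap i (i + 1)) ((X j - X (j + 1)) * g : MvPolynomial ℕ ℤ) =
      (X j - X (j + 1)) * rename (Equiv.swap i (i + 1)) g := by
    intro g
    rw [map_mul, map_sub, rename_X, rename_X, Equiv.swap_apply_of_ne_of_ne (by omega) (by omega),
      Equiv.swap_apply_of_ne_of_ne (by omega) (by omega)]
  have e1 := mul_divDiff i (divDiff j f)
  have e2 := mul_divDiff j (divDiff i f)
  have e3 := mul_divDiff j f
  have e4 := mul_divDiff i f
  have e5 := hi (divDiff i f)
  have e6 := hj (divDiff j f)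
  rw [e4, map_sub] at e5
  rw [e3, map_sub] at e6
  refine mul_left_cancel₀ (X_sub_X_ne_zero (Nat.succ_ne_self i).symm)
    (mul_left_cancel₀ (X_sub_X_ne_zero (Nat.succ_ne_self j).symm) ?_)
  linear_combination (X j - X (j + 1)) * e1 + e3 + e6 + hst - (X i - X (i + 1)) * e2 - e4 - e5

theorem divDiff_braid (i : ℕ) (f : MvPolynomial ℕ ℤ) :
    divDiff i (divDiff (i + 1) (divDiff i f)) =
      divDiff (i + 1) (divDiff i (divDiff (i + 1) f)) := by
  have hx : ∀ g : MvPolynomial ℕ ℤ,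
      rename (Equiv.swap i (i + 1)) (rename (Equiv.swap (i + 1) (i + 1 + 1))
        (rename (Equiv.swap i (i + 1)) g)) =
      rename (Equiv.swap (i + 1) (i + 1 + 1)) (rename (Equiv.swap i (i + 1))
        (rename (Equiv.swap (i + 1) (i + 1 + 1)) g)) := by
    intro g
    simp only [rename_rename]
    congr 2
    ext x
    simp only [Function.comp, Equiv.swap_apply_def]
    split_ifs <;> omega
  have s1 : Equiv.swap i (i + 1) (i + 1 + 1) = i + 1 + 1 :=
    Equiv.swap_apply_of_ne_of_ne (by omega) (by omega)
  have s2 : Equiv.swap (i + 1) (i + 1 + 1) i = i :=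
    Equiv.swap_apply_of_ne_of_ne (by omega) (by omega)
  set s := rename (R := ℤ) (Equiv.swap i (i + 1)) with hs
  set t := rename (R := ℤ) (Equiv.swap (i + 1) (i + 1 + 1)) with ht
  have sa : s (X i) = X (i + 1) := by rw [hs, rename_X, Equiv.swap_apply_left]
  have sb : s (X (i + 1)) = X i := by rw [hs, rename_X, Equiv.swap_apply_right]
  have sc : s (X (i + 1 + 1)) = X (i + 1 + 1) := by rw [hs, rename_X, s1]
  have ta : t (X i) = X i := by rw [ht, rename_X, s2]
  have tb : t (X (i + 1)) = X (i + 1 + 1) := by rw [ht, rename_X, Equiv.swap_apply_left]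
  have tc : t (X (i + 1 + 1)) = X (i + 1) := by rw [ht, rename_X, Equiv.swap_apply_right]
  have ss : ∀ g, s (s g) = g := rename_swap_rename_swap i (i + 1)
  have tt : ∀ g, t (t g) = g := rename_swap_rename_swap (i + 1) (i + 1 + 1)
  have dS : ∀ g, (X i - X (i + 1)) * divDiff i g = g - s g := mul_divDiff i
  have dT : ∀ g, (X (i + 1) - X (i + 1 + 1)) * divDiff (i + 1) g = g - t g :=
    mul_divDiff (i + 1)
  have ab := X_sub_X_ne_zero (show i ≠ i + 1 by omega)
  have ac := X_sub_X_ne_zero (show i ≠ i + 1 + 1 by omega)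
  have bc := X_sub_X_ne_zero (show i + 1 ≠ i + 1 + 1 by omega)
  have key1 : (X i - X (i + 1)) * ((X i - X (i + 1 + 1)) * (X (i + 1) - X (i + 1 + 1))) *
      divDiff i (divDiff (i + 1) (divDiff i f)) =
      f - s f - t f + t (s f) + s (t f) - s (t (s f)) := by
    have e1 := dS f
    have e2 := congrArg t e1
    have e3 := dT (divDiff i f)
    have e4 := congrArg s e2
    have e5 := congrArg s e3
    have e6 := dS (divDiff (i + 1) (divDiff i f))
    have e7 := congrArg s e1
    simp only [map_mul, map_sub, sa, sb, sc, ta, tb, ss] at e2 e4 e5 e7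
    refine mul_left_cancel₀ ab ?_
    linear_combination
      (X i - X (i + 1)) * (X i - X (i + 1 + 1)) * (X (i + 1) - X (i + 1 + 1)) * e6 +
      (X i - X (i + 1)) * (X i - X (i + 1 + 1)) * e3 + (X i - X (i + 1 + 1)) * e1 -
      (X i - X (i + 1)) * e2 - (X i - X (i + 1)) * (X (i + 1) - X (i + 1 + 1)) * e5 +
      (X (i + 1) - X (i + 1 + 1)) * e7 + (X i - X (i + 1)) * e4
  have key2 : (X i - X (i + 1)) * ((X i - X (i + 1 + 1)) * (X (i + 1) - X (i + 1 + 1))) *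
      divDiff (i + 1) (divDiff i (divDiff (i + 1) f)) =
      f - s f - t f + t (s f) + s (t f) - t (s (t f)) := by
    have e1 := dT f
    have e2 := congrArg s e1
    have e3 := dS (divDiff (i + 1) f)
    have e4 := congrArg t e2
    have e5 := congrArg t e3
    have e6 := dT (divDiff i (divDiff (i + 1) f))
    have e7 := congrArg t e1
    simp only [map_mul, map_sub, sb, sc, ta, tb, tc, tt] at e2 e4 e5 e7
    refine mul_left_cancel₀ bc ?_
    linear_combination
      (X i - X (i + 1)) * (X i - X (i + 1 + 1)) * (X (i + 1) - X (i + 1 + 1)) * e6 +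
      (X (i + 1) - X (i + 1 + 1)) * (X i - X (i + 1 + 1)) * e3 + (X i - X (i + 1 + 1)) * e1 -
      (X (i + 1) - X (i + 1 + 1)) * e2 - (X i - X (i + 1)) * (X (i + 1) - X (i + 1 + 1)) * e5 +
      (X i - X (i + 1)) * e7 + (X (i + 1) - X (i + 1 + 1)) * e4
  refine mul_left_cancel₀ (mul_ne_zero ab (mul_ne_zero ac bc)) ?_
  rw [key1, key2, hx]

theorem homogeneousComponent_linear_mul {p : MvPolynomial ℕ ℤ} (hp : p.IsHomogeneous 1)
    (d : ℕ) (g : MvPolynomial ℕ ℤ) :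
    homogeneousComponent (d + 1) (p * g) = p * homogeneousComponent d g := by
  have h : ∀ j, homogeneousComponent (d + 1) (p * homogeneousComponent j g) =
      if d = j then p * homogeneousComponent j g else 0 := by
    intro j
    have := hp.mul (homogeneousComponent_isHomogeneous j g)
    rw [homogeneousComponent_of_mem this]
    congr 1
    exact propext (by omega)
  conv_lhs => rw [← sum_homogeneousComponent g]
  rw [Finset.mul_sum, map_sum]
  simp_rw [h]
  rw [Finset.sum_ite_eq]
  split_ifs with hd
  · rfl
  · rw [homogeneousComponent_eq_zero _ _ (by simpa using hd), mul_zero]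

theorem divDiff_isHomogeneous {d : ℕ} {f : MvPolynomial ℕ ℤ} (hf : f.IsHomogeneous (d + 1))
    (i : ℕ) : (divDiff i f).IsHomogeneous d := by
  have h := mul_divDiff i f
  have h1 := homogeneousComponent_linear_mul
    ((isHomogeneous_X ℤ i).sub (isHomogeneous_X ℤ (i + 1))) d (divDiff i f)
  rw [h, homogeneousComponent_eq_self (hf.sub hf.rename_isHomogeneous), ← h] at h1
  rw [mul_left_cancel₀ (X_sub_X_ne_zero (Nat.succ_ne_self i).symm) h1]
  exact homogeneousComponent_isHomogeneous d _

end DividedDifference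

section Inversions

/-- the inversions of `w` among the first `n` positions. -/
noncomputable def inversions (n : ℕ) (w : Equiv.Perm ℕ) : Finset (ℕ × ℕ) :=
  (Finset.range n ×ˢ Finset.range n).filter fun p => p.1 < p.2 ∧ w p.2 < w p.1

theorem mem_inversions {n : ℕ} {w : Equiv.Perm ℕ} {a b : ℕ} :
    (a, b) ∈ inversions n w ↔ b < n ∧ a < b ∧ w b < w a := by
  simp only [inversions, Finset.mem_filter, Finset.mem_product, Finset.mem_range]
  exact ⟨fun h => ⟨h.1.2, h.2⟩, fun h => ⟨⟨h.2.1.trans h.1, h.1⟩, h.2⟩⟩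

theorem card_inversions_le (n : ℕ) (w : Equiv.Perm ℕ) : (inversions n w).card ≤ n * n :=
  (Finset.card_filter_le _ _).trans (by simp)

theorem card_inversions_mul_swap {n i : ℕ} {w : Equiv.Perm ℕ} (hi : i + 1 < n)
    (hw : w i < w (i + 1)) :
    (inversions n (w * Equiv.swap i (i + 1))).card = (inversions n w).card + 1 := by
  have h : inversions n (w * Equiv.swap i (i + 1)) =
      insert (i, i + 1) ((inversions n w).image
        (Prod.map (Equiv.swap i (i + 1)) (Equiv.swap i (i + 1)))) := by
    ext ⟨a, b⟩
    simp only [Finset.mem_insert, Finset.mem_image, Prod.exists, Prod.map_apply, mem_inversions,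
      Equiv.Perm.mul_apply, Prod.mk.injEq]
    constructor
    · rintro ⟨hb, hab, hlt⟩
      by_cases he : a = i ∧ b = i + 1
      · exact Or.inl he
      · refine Or.inr ⟨Equiv.swap i (i + 1) a, Equiv.swap i (i + 1) b, ⟨?_, ?_, hlt⟩, by simp⟩
        · rw [Equiv.swap_apply_def]
          split_ifs <;> omega
        · rw [Equiv.swap_apply_def, Equiv.swap_apply_def]
          split_ifs <;> omega
    · rintro (⟨rfl, rfl⟩ | ⟨c, d, ⟨hd, hcd, hlt⟩, rfl, rfl⟩)
      · simpa using ⟨hi, hw⟩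
      · have he : ¬(c = i ∧ d = i + 1) := by
          rintro ⟨rfl, rfl⟩
          omega
        refine ⟨?_, ?_, by simpa using hlt⟩
        · rw [Equiv.swap_apply_def]
          split_ifs <;> omega
        · rw [Equiv.swap_apply_def, Equiv.swap_apply_def]
          split_ifs <;> omega
  rw [h, Finset.card_insert_of_notMem, Finset.card_image_of_injective]
  · exact (Equiv.injective _).prodMap (Equiv.injective _)
  · simp only [Finset.mem_image, Prod.exists, Prod.map_apply, mem_inversions, Prod.mk.injEq]
    rintro ⟨c, d, ⟨-, hcd, -⟩, hc, hd⟩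
    rw [Equiv.swap_apply_eq_iff] at hc hd
    simp at hc hd
    omega

theorem inSymm_mul_swap {n i : ℕ} {w : Equiv.Perm ℕ} (hw : InSymm n w) (hi : i + 1 < n) :
    InSymm n (w * Equiv.swap i (i + 1)) := by
  intro m hm
  rw [Equiv.Perm.mul_apply, Equiv.swap_apply_of_ne_of_ne (by omega) (by omega), hw m hm]

theorem inSymm_mono {n m : ℕ} {w : Equiv.Perm ℕ} (hw : InSymm n w) (h : n ≤ m) : InSymm m w :=
  fun k hk => hw k (h.trans hk)

theorem lt_of_inSymm {n i : ℕ} {w : Equiv.Perm ℕ} (hw : InSymm n w) (hi : i < n) : w i < n := by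
  by_contra! h
  have := w.injective (hw _ h)
  omega

theorem lt_of_no_ascent {n : ℕ} {w : Equiv.Perm ℕ}
    (h : ∀ i, i + 1 < n → ¬ w i < w (i + 1)) {i j : ℕ} (hij : i < j) (hj : j < n) :
    w j < w i := by
  induction j, hij using Nat.le_induction with
  | base =>
    have := w.injective.ne (Nat.succ_ne_self i)
    have := h i hj
    simp only [Nat.succ_eq_add_one] at *
    omega
  | succ k hk ih =>
    have := w.injective.ne (Nat.succ_ne_self k)
    have := h k hj
    have := ih (by omega)
    simp only [Nat.succ_eq_add_one] at *
    omega

theorem eq_one_of_inversions_card_eq_zero {n : ℕ} {w : Equiv.Perm ℕ} (hw : InSymm n w)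
    (h : (inversions n w).card = 0) : w = 1 := by
  have hm : StrictMono w := by
    intro a b hab
    by_contra! hle
    have hne := w.injective.ne hab.ne
    have hbn : b < n := by
      by_contra! hb
      rw [hw b hb] at hle
      rcases lt_or_ge a n with ha | ha
      · have := lt_of_inSymm hw ha
        omega
      · rw [hw a ha] at hle
        omega
    have : (a, b) ∈ inversions n w := mem_inversions.2 ⟨hbn, hab, by omega⟩
    rw [Finset.card_eq_zero.1 h] at this
    simp at this
  have hm' : StrictMono w.symm := by
    intro a b hab
    by_contra! hle
    have := hm.monotone hle
    simp at this
    omega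
  ext m
  have h1 := hm.id_le m
  have h2 := hm.monotone (hm'.id_le m)
  simp at h1 h2
  simp
  omega

end Inversions

section WellDefined

/-- `IsSchubert n w f` says that `f` arises from `staircase n` by divided differences along some
chain of ascents from `w` to the longest element of `S_n`. -/
inductive IsSchubert (n : ℕ) : Equiv.Perm ℕ → MvPolynomial ℕ ℤ → Prop
  | base (w : Equiv.Perm ℕ) (h : ∀ i, i + 1 < n → ¬ w i < w (i + 1)) :
      IsSchubert n w (staircase n)
  | step (w : Equiv.Perm ℕ) (f : MvPolynomial ℕ ℤ) (i : ℕ) (hi : i + 1 < n)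
      (hw : w i < w (i + 1)) (hf : IsSchubert n (w * Equiv.swap i (i + 1)) f) :
      IsSchubert n w (divDiff i f)

theorem isSchubert_schubertAux (n k : ℕ) (w : Equiv.Perm ℕ)
    (hk : n * n ≤ k + (inversions n w).card) : IsSchubert n w (SchubertAux n k w) := by
  induction k generalizing w with
  | zero =>
    refine IsSchubert.base w fun i hi hw => ?_
    have h1 := card_inversions_mul_swap hi hw
    have h2 := card_inversions_le n (w * Equiv.swap i (i + 1))
    omega
  | succ k ih =>
    rw [SchubertAux]
    split_ifs with h
    · refine IsSchubert.step w _ _ h.choose_spec.1 h.choose_spec.2 (ih _ ?_)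
      rw [card_inversions_mul_swap h.choose_spec.1 h.choose_spec.2]
      omega
    · exact IsSchubert.base w fun i hi hw => h ⟨i, hi, hw⟩

theorem exists_isSchubert (n : ℕ) (w : Equiv.Perm ℕ) : ∃ f, IsSchubert n w f :=
  ⟨_, isSchubert_schubertAux n (n * n) w (Nat.le_add_right _ _)⟩

theorem mul_swap_comm (w : Equiv.Perm ℕ) {i j : ℕ} (h : i + 1 < j) :
    w * Equiv.swap i (i + 1) * Equiv.swap j (j + 1) =
      w * Equiv.swap j (j + 1) * Equiv.swap i (i + 1) := by
  ext x
  simp only [Equiv.Perm.mul_apply]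
  congr 1
  simp only [Equiv.swap_apply_def]
  split_ifs <;> omega

theorem mul_swap_braid (w : Equiv.Perm ℕ) (i : ℕ) :
    w * Equiv.swap i (i + 1) * Equiv.swap (i + 1) (i + 1 + 1) * Equiv.swap i (i + 1) =
      w * Equiv.swap (i + 1) (i + 1 + 1) * Equiv.swap i (i + 1) *
        Equiv.swap (i + 1) (i + 1 + 1) := by
  ext x
  simp only [Equiv.Perm.mul_apply]
  congr 1
  simp only [Equiv.swap_apply_def]
  split_ifs <;> omega

theorem divDiff_eq_divDiff_of_lt {n : ℕ} {w : Equiv.Perm ℕ}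
    (ih : ∀ v : Equiv.Perm ℕ, (inversions n w).card < (inversions n v).card →
      ∀ f g, IsSchubert n v f → IsSchubert n v g → f = g)
    {i j : ℕ} (hij : i < j) (hj : j + 1 < n) (hwi : w i < w (i + 1)) (hwj : w j < w (j + 1))
    {f g : MvPolynomial ℕ ℤ} (hf : IsSchubert n (w * Equiv.swap i (i + 1)) f)
    (hg : IsSchubert n (w * Equiv.swap j (j + 1)) g) : divDiff i f = divDiff j g := by
  have ci := card_inversions_mul_swap (by omega) hwi (n := n)
  have cj := card_inversions_mul_swap hj hwj
  rcases Nat.lt_or_ge (i + 1) j with h | h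
  · obtain ⟨p, hp⟩ := exists_isSchubert n (w * Equiv.swap i (i + 1) * Equiv.swap j (j + 1))
    have hf' := IsSchubert.step _ _ j hj (by
      rw [Equiv.Perm.mul_apply, Equiv.Perm.mul_apply,
        Equiv.swap_apply_of_ne_of_ne (by omega) (by omega),
        Equiv.swap_apply_of_ne_of_ne (by omega) (by omega)]
      exact hwj) hp
    rw [mul_swap_comm w h] at hp
    have hg' := IsSchubert.step _ _ i (by omega) (by
      rw [Equiv.Perm.mul_apply, Equiv.Perm.mul_apply,
        Equiv.swap_apply_of_ne_of_ne (by omega) (by omega),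
        Equiv.swap_apply_of_ne_of_ne (by omega) (by omega)]
      exact hwi) hp
    rw [ih _ (by omega) _ _ hf hf', ih _ (by omega) _ _ hg hg', divDiff_comm h]
  · obtain rfl : j = i + 1 := by omega
    have s1 : Equiv.swap i (i + 1) (i + 1 + 1) = i + 1 + 1 :=
      Equiv.swap_apply_of_ne_of_ne (by omega) (by omega)
    have s2 : Equiv.swap (i + 1) (i + 1 + 1) i = i :=
      Equiv.swap_apply_of_ne_of_ne (by omega) (by omega)
    obtain ⟨p, hp⟩ := exists_isSchubert n (w * Equiv.swap i (i + 1) *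
      Equiv.swap (i + 1) (i + 1 + 1) * Equiv.swap i (i + 1))
    have hf' := IsSchubert.step _ _ (i + 1) hj (by
      simpa [s1] using hwi.trans hwj) (IsSchubert.step _ _ i (by omega) (by
      simpa [s1, s2] using hwj) hp)
    rw [mul_swap_braid] at hp
    have hg' := IsSchubert.step _ _ i (by omega) (by
      simpa [s2] using hwi.trans hwj) (IsSchubert.step _ _ (i + 1) hj (by
      simpa [s1, s2] using hwi) hp)
    rw [ih _ (by omega) _ _ hf hf', ih _ (by omega) _ _ hg hg', divDiff_braid]

theorem IsSchubert.unique {n : ℕ} {w : Equiv.Perm ℕ} {f g : MvPolynomial ℕ ℤ}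
    (hf : IsSchubert n w f) (hg : IsSchubert n w g) : f = g := by
  induction hk : n * n - (inversions n w).card using Nat.strong_induction_on
    generalizing w f g with
  | _ k ih =>
  have ih' : ∀ v : Equiv.Perm ℕ, (inversions n w).card < (inversions n v).card →
      ∀ f g, IsSchubert n v f → IsSchubert n v g → f = g := by
    intro v hv f g hf hg
    have := card_inversions_le n v
    exact ih _ (by omega) hf hg rfl
  cases hf with
  | base _ h =>
    cases hg with
    | base _ _ => rfl
    | step _ _ i hi hw _ => exact absurd hw (h i hi)
  | step _ f i hi hwi hf =>
    cases hg with
    | base _ h => exact absurd hwi (h i hi)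
    | step _ g j hj hwj hg =>
      rcases lt_trichotomy i j with h | rfl | h
      · exact divDiff_eq_divDiff_of_lt ih' h hj hwi hwj hf hg
      · rw [ih' _ (by rw [card_inversions_mul_swap hi hwi]; omega) _ _ hf hg]
      · exact (divDiff_eq_divDiff_of_lt ih' h hi hwj hwi hg hf).symm

theorem card_inversions_of_no_ascent {n : ℕ} {w : Equiv.Perm ℕ}
    (h : ∀ i, i + 1 < n → ¬ w i < w (i + 1)) :
    (inversions n w).card = ∑ i ∈ Finset.range n, (n - 1 - i) := by
  have : inversions n w =
      ((Finset.range n).sigma fun i => Finset.Ico (i + 1) n : Finset (Σ _ : ℕ, ℕ)).image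
        fun p => (p.1, p.2) := by
    ext ⟨a, b⟩
    simp only [mem_inversions, Finset.mem_image, Finset.mem_sigma, Finset.mem_range,
      Finset.mem_Ico, Sigma.exists, Prod.mk.injEq]
    constructor
    · rintro ⟨h1, h2, -⟩
      exact ⟨a, b, ⟨by omega, by omega, h1⟩, rfl, rfl⟩
    · rintro ⟨_, _, ⟨_, h1, h2⟩, rfl, rfl⟩
      exact ⟨h2, h1, lt_of_no_ascent h h1 h2⟩
  rw [this, Finset.card_image_of_injective, Finset.card_sigma]
  · refine Finset.sum_congr rfl fun i _ => ?_
    rw [Nat.card_Ico]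
    omega
  · rintro ⟨a, b⟩ ⟨c, d⟩ h
    simpa using h

theorem IsSchubert.isHomogeneous {n : ℕ} {w : Equiv.Perm ℕ} {f : MvPolynomial ℕ ℤ}
    (hf : IsSchubert n w f) : f.IsHomogeneous (inversions n w).card := by
  induction hf with
  | base w h =>
    rw [card_inversions_of_no_ascent h]
    refine IsHomogeneous.prod _ _ _ fun i _ => ?_
    simpa using (isHomogeneous_X ℤ i).pow (n - 1 - i)
  | step w f i hi hw _ ih =>
    rw [card_inversions_mul_swap hi hw] at ih
    exact divDiff_isHomogeneous ih i

/-- Multiplication by `X p` undoes `divDiff p` on polynomials symmetric in `X p`, `X (p + 1)`. -/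
theorem divDiff_mul_X {p : ℕ} {A : MvPolynomial ℕ ℤ}
    (hA : rename (Equiv.swap p (p + 1)) A = A) : divDiff p (A * X p) = A := by
  apply divDiff_eq_of_mul_eq
  rw [map_mul, hA, rename_X, Equiv.swap_apply_left]
  ring

theorem rename_swap_staircase_mul {n p : ℕ} (hp : p < n) :
    rename (Equiv.swap p (p + 1)) (staircase n * ∏ i ∈ Finset.Ico (p + 1) n, X i) =
      staircase n * ∏ i ∈ Finset.Ico (p + 1) n, X i := by
  have h : (staircase n * ∏ i ∈ Finset.Ico (p + 1) n, X i : MvPolynomial ℕ ℤ) =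
      ∏ i ∈ Finset.range (n + 1), X i ^ (if i < p + 1 then n - 1 - i else n - i) := by
    rw [staircase, Finset.prod_range_succ, if_neg (by omega), Nat.sub_self, pow_zero, mul_one,
      ← Finset.prod_range_mul_prod_Ico _ (show p + 1 ≤ n by omega), mul_assoc,
      ← Finset.prod_mul_distrib,
      ← Finset.prod_range_mul_prod_Ico (fun i => (X i : MvPolynomial ℕ ℤ) ^ _)
        (show p + 1 ≤ n by omega)]
    congr 1
    · refine Finset.prod_congr rfl fun i hi => ?_
      rw [if_pos (Finset.mem_range.1 hi)]
    · refine Finset.prod_congr rfl fun i hi => ?_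
      rw [Finset.mem_Ico] at hi
      rw [if_neg (by omega), ← pow_succ]
      congr 1
      omega
  rw [h, map_prod]
  refine Finset.prod_bij' (fun i _ => Equiv.swap p (p + 1) i) (fun i _ => Equiv.swap p (p + 1) i)
    ?_ ?_ ?_ ?_ ?_
  · intro i hi
    rw [Finset.mem_range] at hi ⊢
    rw [Equiv.swap_apply_def]
    split_ifs <;> omega
  · intro i hi
    rw [Finset.mem_range] at hi ⊢
    rw [Equiv.swap_apply_def]
    split_ifs <;> omega
  · simp
  · simp
  · intro i hi
    rw [map_pow, rename_X]
    congr 1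
    rw [Equiv.swap_apply_def]
    split_ifs <;> omega

theorem isSchubert_of_max_at {n p : ℕ} (hp : p ≤ n) {w : Equiv.Perm ℕ} (hwp : w p = n)
    (hle : ∀ i ≤ n, w i ≤ n)
    (hdec : ∀ i j, i < j → j ≤ n → i ≠ p → j ≠ p → w j < w i) :
    IsSchubert (n + 1) w (staircase n * ∏ i ∈ Finset.Ico p n, X i) := by
  induction p generalizing w with
  | zero =>
    have h : (staircase n * ∏ i ∈ Finset.Ico 0 n, X i : MvPolynomial ℕ ℤ) =
        staircase (n + 1) := by
      rw [staircase, staircase, Finset.prod_range_succ, ← Finset.range_eq_Ico,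
        ← Finset.prod_mul_distrib]
      simp only [Nat.add_sub_cancel, Nat.sub_self, pow_zero, mul_one]
      refine Finset.prod_congr rfl fun i hi => ?_
      rw [Finset.mem_range] at hi
      rw [← pow_succ]
      congr 1
      omega
    rw [h]
    refine IsSchubert.base w fun i hi => ?_
    rcases Nat.eq_zero_or_pos i with rfl | h0
    · have := hle (0 + 1) (by omega)
      omega
    · have := hdec i (i + 1) (by omega) (by omega) (by omega) (by omega)
      omega
  | succ p ih =>
    have hlt : w p < w (p + 1) := by
      have h1 := hle p (by omega)
      have h2 := w.injective.ne (Nat.succ_ne_self p)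
      simp only [Nat.succ_eq_add_one] at h2
      omega
    have hrec : IsSchubert (n + 1) (w * Equiv.swap p (p + 1))
        (staircase n * ∏ i ∈ Finset.Ico p n, X i) := by
      apply ih (by omega)
      · simpa using hwp
      · intro i hi
        apply hle
        rw [Equiv.swap_apply_def]
        split_ifs <;> omega
      · intro i j hij hj hi hj'
        rw [Equiv.Perm.mul_apply, Equiv.Perm.mul_apply]
        apply hdec <;> simp only [Equiv.swap_apply_def] <;> split_ifs <;> omega
    have h := IsSchubert.step w _ p (by omega) hlt hrec
    rwa [Finset.prod_eq_prod_Ico_succ_bot (by omega), mul_comm (X p), ← mul_assoc,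
      divDiff_mul_X (rename_swap_staircase_mul (by omega))] at h

theorem IsSchubert.succ {n : ℕ} {w : Equiv.Perm ℕ} {f : MvPolynomial ℕ ℤ}
    (hf : IsSchubert n w f) (hw : InSymm n w) : IsSchubert (n + 1) w f := by
  induction hf with
  | base w h =>
    have := isSchubert_of_max_at le_rfl (hw n le_rfl) ?_ ?_
    · simpa using this
    · intro i hi
      rcases hi.lt_or_eq with h | rfl
      · exact (lt_of_inSymm hw h).le
      · exact (hw i le_rfl).le
    · intro i j hij hj hi hj'
      exact lt_of_no_ascent h hij (by omega)
  | step w f i hi hlt _ ih =>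
    exact IsSchubert.step w f i (by omega) hlt (ih (inSymm_mul_swap hw hi))

theorem IsSchubert.mono {n m : ℕ} (h : n ≤ m) {w : Equiv.Perm ℕ} {f : MvPolynomial ℕ ℤ}
    (hf : IsSchubert n w f) (hw : InSymm n w) : IsSchubert m w f := by
  induction m, h using Nat.le_induction with
  | base => exact hf
  | succ k hk ih => exact ih.succ (inSymm_mono hw hk)

theorem isSchubert_schubert {n : ℕ} {w : Equiv.Perm ℕ} (hw : InSymm n w) :
    IsSchubert n w (Schubert w) := by
  have hfin : IsFinPerm w := ⟨n, hw⟩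
  rw [Schubert, dif_pos hfin]
  have h1 := isSchubert_schubertAux hfin.choose (hfin.choose * hfin.choose) w
    (Nat.le_add_right _ _)
  obtain ⟨f, hf⟩ := exists_isSchubert n w
  have h2 := h1.mono (le_max_left hfin.choose n) hfin.choose_spec
  rwa [h2.unique (hf.mono (le_max_right hfin.choose n) hw)]

end WellDefined

section Coefficients

theorem isFinPerm_mul_swap {w : Equiv.Perm ℕ} (hw : IsFinPerm w) (i : ℕ) :
    IsFinPerm (w * Equiv.swap i (i + 1)) := by
  obtain ⟨n, hn⟩ := hw
  exact ⟨max n (i + 2), inSymm_mul_swap (inSymm_mono hn (le_max_left _ _))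
    (lt_of_lt_of_le (Nat.lt_succ_self _) (le_max_right n (i + 2)))⟩

theorem divDiff_schubert_of_descent {w : Equiv.Perm ℕ} (hw : IsFinPerm w) {i : ℕ}
    (h : w (i + 1) < w i) : divDiff i (Schubert w) = Schubert (w * Equiv.swap i (i + 1)) := by
  obtain ⟨n, hn⟩ := hw
  have hi : i + 1 < max n (i + 2) :=
    lt_of_lt_of_le (Nat.lt_succ_self _) (le_max_right n (i + 2))
  have hm := inSymm_mono hn (le_max_left n (i + 2))
  have h1 := IsSchubert.step (w * Equiv.swap i (i + 1)) (Schubert w) i hi (by simpa using h)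
    (by simpa [mul_assoc] using isSchubert_schubert hm)
  exact h1.unique (isSchubert_schubert (inSymm_mul_swap hm hi))

theorem divDiff_schubert_of_ascent {w : Equiv.Perm ℕ} (hw : IsFinPerm w) {i : ℕ}
    (h : w i < w (i + 1)) : divDiff i (Schubert w) = 0 := by
  have h1 := divDiff_schubert_of_descent (isFinPerm_mul_swap hw i) (i := i) (by simpa using h)
  have h2 : w * Equiv.swap i (i + 1) * Equiv.swap i (i + 1) = w := by simp [mul_assoc]
  rw [h2] at h1
  rw [← h1, divDiff_divDiff]

theorem schubert_isHomogeneous {n : ℕ} {w : Equiv.Perm ℕ} (hw : InSymm n w) :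
    (Schubert w).IsHomogeneous (inversions n w).card :=
  (isSchubert_schubert hw).isHomogeneous

theorem schubert_one : Schubert 1 = 1 := by
  have h := isSchubert_schubert (n := 0) (w := 1) fun m _ => rfl
  exact h.unique (by simpa [staircase] using IsSchubert.base (n := 0) 1 (by simp))

/-- `φ` extracts the coefficient of `Schubert w` from a combination of Schubert polynomials. -/
def IsDual (w : Equiv.Perm ℕ) (φ : MvPolynomial ℕ ℤ →+ ℤ) : Prop :=
  ∀ v, IsFinPerm v → φ (Schubert v) = if v = w then 1 else 0

theorem isDual_one : IsDual 1 (constantCoeff (σ := ℕ) (R := ℤ)).toAddMonoidHom := by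
  rintro v ⟨n, hv⟩
  split_ifs with h
  · simp [h, schubert_one]
  · have h0 : (inversions n v).card ≠ 0 := fun h0 => h (eq_one_of_inversions_card_eq_zero hv h0)
    exact (schubert_isHomogeneous hv).coeff_eq_zero (by simpa using h0.symm)

theorem IsDual.comp_divDiff {w : Equiv.Perm ℕ} {i : ℕ} (h : w (i + 1) < w i)
    {φ : MvPolynomial ℕ ℤ →+ ℤ} (hφ : IsDual (w * Equiv.swap i (i + 1)) φ) :
    IsDual w (φ.comp (divDiffHom i)) := by
  intro v hv
  change φ (divDiff i (Schubert v)) = _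
  have hne := v.injective.ne (Nat.succ_ne_self i)
  rcases lt_or_gt_of_ne hne with hd | ha
  · rw [divDiff_schubert_of_descent hv hd, hφ _ (isFinPerm_mul_swap hv i)]
    simp only [mul_left_inj]
  · rw [divDiff_schubert_of_ascent hv ha, map_zero, if_neg]
    rintro rfl
    exact lt_asymm h ha

theorem exists_isDual {w : Equiv.Perm ℕ} (hw : IsFinPerm w) : ∃ φ, IsDual w φ := by
  obtain ⟨n, hn⟩ := hw
  induction hk : (inversions n w).card generalizing w with
  | zero =>
    rw [eq_one_of_inversions_card_eq_zero hn hk]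
    exact ⟨_, isDual_one⟩
  | succ k ih =>
    have hex : ∃ i, i + 1 < n ∧ w (i + 1) < w i := by
      by_contra! hno
      have hmono : ∀ a b, a < b → b < n → w a ≤ w b := by
        intro a b hab
        induction b, hab using Nat.le_induction with
        | base => exact hno a
        | succ c hc ih' => exact fun h => (ih' (by omega)).trans (hno c h)
      have : inversions n w = ∅ := by
        rw [Finset.eq_empty_iff_forall_notMem]
        rintro ⟨a, b⟩ hab
        rw [mem_inversions] at hab
        exact absurd (hmono a b hab.2.1 hab.1) (by omega)
      rw [this] at hk
      simp at hk
    obtain ⟨i, hi, hd⟩ := hex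
    have hc := card_inversions_mul_swap (w := w * Equiv.swap i (i + 1)) hi (by simpa using hd)
    have hss : w * Equiv.swap i (i + 1) * Equiv.swap i (i + 1) = w := by simp [mul_assoc]
    rw [hss] at hc
    obtain ⟨φ, hφ⟩ := ih (inSymm_mul_swap hn hi) (by omega)
    exact ⟨_, hφ.comp_divDiff hd⟩

theorem IsDual.coeff_eq {u v w : Equiv.Perm ℕ} {φ : MvPolynomial ℕ ℤ →+ ℤ} (hφ : IsDual w φ)
    {c : Equiv.Perm ℕ →₀ ℕ} (hc : IsSchubertCoeff u v c) :
    (c w : ℤ) = φ (Schubert u * Schubert v) := by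
  rw [hc.2, Finsupp.sum, map_sum]
  have h : ∀ x ∈ c.support, φ ((c x : MvPolynomial ℕ ℤ) * Schubert x) =
      if x = w then (c x : ℤ) else 0 := by
    intro x hx
    rw [← nsmul_eq_mul, map_nsmul, hφ x (hc.1 x hx)]
    split_ifs <;> simp
  rw [Finset.sum_congr rfl h, Finset.sum_ite_eq']
  split_ifs with hw
  · rfl
  · simpa using hw

theorem coeff_eq_zero_of_card_inversions_ne {n : ℕ} {u v w : Equiv.Perm ℕ} (hu : InSymm n u)
    (hv : InSymm n v) (hw : InSymm n w)
    (hne : (inversions n u).card + (inversions n v).card ≠ (inversions n w).card)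
    {c : Equiv.Perm ℕ →₀ ℕ} (hc : IsSchubertCoeff u v c) : c w = 0 := by
  obtain ⟨φ, hφ⟩ := exists_isDual ⟨n, hw⟩
  have hψ : IsDual w (φ.comp
      (homogeneousComponent (inversions n w).card (R := ℤ) (σ := ℕ)).toAddMonoidHom) := by
    rintro x ⟨m, hx⟩
    have hN := schubert_isHomogeneous (inSymm_mono hx (le_max_right n m))
    have hW := schubert_isHomogeneous (inSymm_mono hw (le_max_left n m))
    change φ (homogeneousComponent _ (Schubert x)) = _
    rw [homogeneousComponent_of_mem hN]
    split_ifs with h1 h2 h2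
    · rw [hφ x ⟨m, hx⟩, if_pos h2]
    · rw [hφ x ⟨m, hx⟩, if_neg h2]
    · subst h2
      have h0 : Schubert x ≠ 0 := by
        intro h0
        have := hφ x ⟨m, hx⟩
        simp [h0] at this
      exact absurd ((schubert_isHomogeneous hw).inj_right hN h0) h1
    · exact map_zero φ
  have h := hψ.coeff_eq hc
  have hz : homogeneousComponent (inversions n w).card (Schubert u * Schubert v) = 0 := by
    rw [homogeneousComponent_of_mem
      ((schubert_isHomogeneous hu).mul (schubert_isHomogeneous hv)), if_neg hne.symm]
  have h' : (c w : ℤ) =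
      φ (homogeneousComponent (inversions n w).card (Schubert u * Schubert v)) := h
  rw [hz, map_zero] at h'
  exact_mod_cast h'

end Coefficients

section RotheDiagram

theorem ncard_rothe {n : ℕ} {w : Equiv.Perm ℕ} (hw : InSymm n w) :
    (rothe w).ncard = (inversions n w).card := by
  have h : rothe w = ↑((inversions n w).image fun p => (p.1, w p.2)) := by
    ext ⟨a, b⟩
    simp only [rothe, Set.mem_ofPred_eq, Finset.coe_image, Set.mem_image, Finset.mem_coe,
      Prod.exists, mem_inversions, Prod.mk.injEq]
    constructor
    · rintro ⟨h1, h2⟩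
      refine ⟨a, w.symm b, ⟨?_, h2, by simpa using h1⟩, rfl, by simp⟩
      by_contra! hn
      have h3 := hw _ hn
      rw [Equiv.apply_symm_apply] at h3
      rcases lt_or_ge a n with ha | ha
      · have := lt_of_inSymm hw ha
        omega
      · have := hw a ha
        omega
    · rintro ⟨_, d, ⟨-, h1, h2⟩, rfl, rfl⟩
      exact ⟨h2, by simpa using h1⟩
  rw [h, Set.ncard_coe_finset, Finset.card_image_of_injective]
  rintro ⟨a, b⟩ ⟨c, d⟩ h
  simpa using h

theorem coeff_eq_zero_of_ncard_rothe_ne {u v w : Equiv.Perm ℕ} (hu : IsFinPerm u)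
    (hv : IsFinPerm v) (hw : IsFinPerm w)
    (hne : (rothe u).ncard + (rothe v).ncard ≠ (rothe w).ncard)
    {c : Equiv.Perm ℕ →₀ ℕ} (hc : IsSchubertCoeff u v c) : c w = 0 := by
  obtain ⟨a, ha⟩ := hu
  obtain ⟨b, hb⟩ := hv
  obtain ⟨d, hd⟩ := hw
  have ha' := inSymm_mono ha (show a ≤ a + b + d by omega)
  have hb' := inSymm_mono hb (show b ≤ a + b + d by omega)
  have hd' := inSymm_mono hd (show d ≤ a + b + d by omega)
  rw [ncard_rothe ha', ncard_rothe hb', ncard_rothe hd'] at hne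
  exact coeff_eq_zero_of_card_inversions_ne ha' hb' hd' hne hc

theorem stretchCol_of_unshaded {k N j : ℕ} {w : Equiv.Perm ℕ}
    (h : ∀ i < j, i ∉ shadedCols k w) : stretchCol k N w j = j := by
  have h1 : {i | i < j ∧ i ∉ shadedCols k w} = ↑(Finset.range j) := by
    ext i
    simpa using h i
  have h2 : {i | i < j ∧ i ∈ shadedCols k w} = ∅ := by
    ext i
    simpa using h i
  rw [stretchCol, h1, h2, Set.ncard_coe_finset, Set.ncard_empty, Finset.card_range, mul_zero,
    add_zero]

end RotheDiagram

section Counterexample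

variable {q : ℕ} {u w : Equiv.Perm ℕ}

theorem swap_apply_cases (i m : ℕ) :
    (m = i ∧ Equiv.swap i (i + 1) m = i + 1) ∨ (m = i + 1 ∧ Equiv.swap i (i + 1) m = i) ∨
      (m ≠ i ∧ m ≠ i + 1 ∧ Equiv.swap i (i + 1) m = m) := by
  rw [Equiv.swap_apply_def]
  split_ifs <;> omega

theorem left_apply_cases (hu1 : ∀ m ≤ q, u m = m + 1) (hu2 : u (q + 1) = 0)
    (hu3 : u (q + 2) = q + 3) (hu4 : u (q + 3) = q + 2) (hu5 : InSymm (q + 4) u) (m : ℕ) :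
    (m ≤ q ∧ u m = m + 1) ∨ (m = q + 1 ∧ u m = 0) ∨ (m = q + 2 ∧ u m = q + 3) ∨
      (m = q + 3 ∧ u m = q + 2) ∨ (q + 4 ≤ m ∧ u m = m) := by
  have h' : m ≤ q ∨ m = q + 1 ∨ m = q + 2 ∨ m = q + 3 ∨ q + 4 ≤ m := by omega
  rcases h' with h' | rfl | rfl | rfl | h'
  · simp [h', hu1]
  · simp [hu2]
  · simp [hu3]
  · simp [hu4]
  · simp [h', hu5 m h']

theorem right_apply_cases (hw1 : ∀ m < q, w m = m + 1) (hw2 : w q = q + 2)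
    (hw3 : w (q + 1) = 0) (hw4 : w (q + 2) = q + 3) (hw5 : w (q + 3) = q + 1)
    (hw6 : InSymm (q + 4) w) (m : ℕ) :
    (m < q ∧ w m = m + 1) ∨ (m = q ∧ w m = q + 2) ∨ (m = q + 1 ∧ w m = 0) ∨
      (m = q + 2 ∧ w m = q + 3) ∨ (m = q + 3 ∧ w m = q + 1) ∨ (q + 4 ≤ m ∧ w m = m) := by
  have h' : m < q ∨ m = q ∨ m = q + 1 ∨ m = q + 2 ∨ m = q + 3 ∨ q + 4 ≤ m := by omega
  rcases h' with h' | rfl | rfl | rfl | rfl | h'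
  · simp [h', hw1]
  · simp [hw2]
  · simp [hw3]
  · simp [hw4]
  · simp [hw5]
  · simp [h', hw6 m h']

set_option maxHeartbeats 2000000 in
theorem coeff_eq_one (hu1 : ∀ m ≤ q, u m = m + 1) (hu2 : u (q + 1) = 0)
    (hu3 : u (q + 2) = q + 3) (hu4 : u (q + 3) = q + 2) (hu5 : InSymm (q + 4) u)
    (hw1 : ∀ m < q, w m = m + 1) (hw2 : w q = q + 2) (hw3 : w (q + 1) = 0)
    (hw4 : w (q + 2) = q + 3) (hw5 : w (q + 3) = q + 1) (hw6 : InSymm (q + 4) w)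
    {c : Equiv.Perm ℕ →₀ ℕ} (hc : IsSchubertCoeff u (Equiv.swap q (q + 1)) c) : c w = 1 := by
  have hvfin : IsFinPerm (Equiv.swap q (q + 1)) :=
    ⟨q + 2, fun m hm => Equiv.swap_apply_of_ne_of_ne (by omega) (by omega)⟩
  have hufin : IsFinPerm u := ⟨_, hu5⟩
  set u₁ := u * Equiv.swap (q + 2) (q + 2 + 1) with hu₁
  set w₁ := w * Equiv.swap (q + 2) (q + 2 + 1) with hw₁
  set u₂ := u₁ * Equiv.swap q (q + 1) with hu₂
  set w₂ := w₁ * Equiv.swap q (q + 1) with hw₂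
  set w₃ := w₂ * Equiv.swap (q + 1) (q + 1 + 1) with hw₃
  have hu₁fin : IsFinPerm u₁ := isFinPerm_mul_swap hufin _
  have hu₂fin : IsFinPerm u₂ := isFinPerm_mul_swap hu₁fin _
  have v_cases := swap_apply_cases q
  have u₁_cases : ∀ m, (m ≤ q ∧ u₁ m = m + 1) ∨ (m = q + 1 ∧ u₁ m = 0) ∨
      (q + 2 ≤ m ∧ u₁ m = m) := by
    intro m
    have h1 : u₁ m = u (Equiv.swap (q + 2) (q + 2 + 1) m) := rfl
    have h2 := swap_apply_cases (q + 2) m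
    have h3 := left_apply_cases hu1 hu2 hu3 hu4 hu5 (Equiv.swap (q + 2) (q + 2 + 1) m)
    rcases h2 with ⟨h2, h5⟩ | ⟨h2, h5⟩ | ⟨h2, h2', h5⟩ <;> rw [h5] at h1 h3 <;> omega
  have u₂_cases : ∀ m, (m < q ∧ u₂ m = m + 1) ∨ (m = q ∧ u₂ m = 0) ∨ (q < m ∧ u₂ m = m) := by
    intro m
    have h1 : u₂ m = u₁ (Equiv.swap q (q + 1) m) := rfl
    have h2 := v_cases m
    have h3 := u₁_cases (Equiv.swap q (q + 1) m)
    rcases h2 with ⟨h2, h5⟩ | ⟨h2, h5⟩ | ⟨h2, h2', h5⟩ <;> rw [h5] at h1 h3 <;> omega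
  have w₁_cases : ∀ m, (m < q ∧ w₁ m = m + 1) ∨ (m = q ∧ w₁ m = q + 2) ∨
      (m = q + 1 ∧ w₁ m = 0) ∨ (m = q + 2 ∧ w₁ m = q + 1) ∨ (q + 3 ≤ m ∧ w₁ m = m) := by
    intro m
    have h1 : w₁ m = w (Equiv.swap (q + 2) (q + 2 + 1) m) := rfl
    have h2 := swap_apply_cases (q + 2) m
    have h3 := right_apply_cases hw1 hw2 hw3 hw4 hw5 hw6 (Equiv.swap (q + 2) (q + 2 + 1) m)
    rcases h2 with ⟨h2, h5⟩ | ⟨h2, h5⟩ | ⟨h2, h2', h5⟩ <;> rw [h5] at h1 h3 <;> omega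
  have w₂_cases : ∀ m, (m < q ∧ w₂ m = m + 1) ∨ (m = q ∧ w₂ m = 0) ∨
      (m = q + 1 ∧ w₂ m = q + 2) ∨ (m = q + 2 ∧ w₂ m = q + 1) ∨ (q + 3 ≤ m ∧ w₂ m = m) := by
    intro m
    have h1 : w₂ m = w₁ (Equiv.swap q (q + 1) m) := rfl
    have h2 := v_cases m
    have h3 := w₁_cases (Equiv.swap q (q + 1) m)
    rcases h2 with ⟨h2, h5⟩ | ⟨h2, h5⟩ | ⟨h2, h2', h5⟩ <;> rw [h5] at h1 h3 <;> omega
  have heq : u₂ = w₃ := by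
    ext m
    have h1 : w₃ m = w₂ (Equiv.swap (q + 1) (q + 1 + 1) m) := rfl
    have h2 := swap_apply_cases (q + 1) m
    have h3 := w₂_cases (Equiv.swap (q + 1) (q + 1 + 1) m)
    have h4 := u₂_cases m
    rcases h2 with ⟨h2, h5⟩ | ⟨h2, h5⟩ | ⟨h2, h2', h5⟩ <;> rw [h5] at h1 h3 <;> omega
  have d1 : divDiff (q + 2) (Schubert u * Schubert (Equiv.swap q (q + 1))) =
      Schubert u₁ * Schubert (Equiv.swap q (q + 1)) := by
    rw [divDiff_mul, divDiff_schubert_of_descent hufin (by rw [hu3, hu4]; omega),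
      divDiff_schubert_of_ascent hvfin (by
      have h1 := v_cases (q + 2)
      have h2 := v_cases (q + 2 + 1)
      omega), mul_zero, add_zero]
  have d2 : divDiff q (Schubert u₁ * Schubert (Equiv.swap q (q + 1))) =
      Schubert u₂ * Schubert (Equiv.swap q (q + 1)) +
        (Schubert u₁ + (X (q + 1) - X q) * Schubert u₂) := by
    have hd : divDiff q (Schubert u₁) = Schubert u₂ :=
      divDiff_schubert_of_descent hu₁fin (by
      have h1 := u₁_cases q
      have h2 := u₁_cases (q + 1)
      omega)
    have hr := mul_divDiff q (Schubert u₁)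
    rw [hd] at hr
    rw [divDiff_mul, hd, divDiff_schubert_of_descent hvfin (by simp), Equiv.swap_mul_self,
      schubert_one]
    linear_combination hr
  have d3 : divDiff (q + 1) (Schubert u₂ * Schubert (Equiv.swap q (q + 1)) +
        (Schubert u₁ + (X (q + 1) - X q) * Schubert u₂)) = Schubert u₂ := by
    have hX : divDiff (q + 1) (X (q + 1) - X q) = 1 := by
      apply divDiff_eq_of_mul_eq
      rw [map_sub, rename_X, rename_X, Equiv.swap_apply_left,
        Equiv.swap_apply_of_ne_of_ne (by omega) (by omega)]
      ring
    have hv0 : divDiff (q + 1) (Schubert (Equiv.swap q (q + 1))) = 0 :=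
      divDiff_schubert_of_ascent hvfin (by
      have h1 := v_cases (q + 1)
      have h2 := v_cases (q + 1 + 1)
      omega)
    have hu₁0 : divDiff (q + 1) (Schubert u₁) = 0 :=
      divDiff_schubert_of_ascent hu₁fin (by
      have h1 := u₁_cases (q + 1)
      have h2 := u₁_cases (q + 1 + 1)
      omega)
    have hu₂0 : divDiff (q + 1) (Schubert u₂) = 0 :=
      divDiff_schubert_of_ascent hu₂fin (by
      have h1 := u₂_cases (q + 1)
      have h2 := u₂_cases (q + 1 + 1)
      omega)
    rw [divDiff_add, divDiff_add, divDiff_mul, divDiff_mul, hX, hv0, hu₁0, hu₂0]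
    ring
  obtain ⟨φ, hφ⟩ := exists_isDual hu₂fin
  have hdual := hφ u₂ hu₂fin
  rw [heq] at hφ
  have h3 := IsDual.comp_divDiff (by
      have h1 := w₂_cases (q + 1)
      have h2 := w₂_cases (q + 1 + 1)
      omega) hφ
  have h2 := IsDual.comp_divDiff (by
      have h1 := w₁_cases q
      have h2 := w₁_cases (q + 1)
      omega) h3
  have h1 := (IsDual.comp_divDiff (by rw [hw4, hw5]; omega) h2).coeff_eq hc
  change (c w : ℤ) = φ (divDiff (q + 1) (divDiff q (divDiff (q + 2) _))) at h1
  rw [d1, d2, d3, hdual, if_pos rfl] at h1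
  exact_mod_cast h1

theorem isBitScale_left_ncard_le (hu1 : ∀ m ≤ q, u m = m + 1) (hu2 : u (q + 1) = 0)
    (hu3 : u (q + 2) = q + 3) (hu4 : u (q + 3) = q + 2) (hu5 : InSymm (q + 4) u)
    {N : ℕ} {u' : Equiv.Perm ℕ} (h : IsBitScale (q + 2) N u u') :
    (rothe u').ncard ≤ q + 1 + N := by
  have hval := left_apply_cases hu1 hu2 hu3 hu4 hu5
  have hsh : ∀ j < q + 2, j ∉ shadedCols (q + 2) u := by
    rintro j hj ⟨r, hr, rfl⟩
    have := hval r
    omega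
  have hs2 : q + 2 ∈ shadedCols (q + 2) u := ⟨q + 3, by omega, hu4⟩
  have hsub : rothe u' ⊆ ↑((Finset.range (q + 1) ×ˢ {0}) ∪
      ({q + 2} ×ˢ Finset.Ico (q + 2) (q + 2 + N)) : Finset (ℕ × ℕ)) := by
    rw [h.2]
    rintro _ ⟨⟨a, b⟩, ⟨h1, h2⟩, m, hm, rfl⟩
    have hb : u (u.symm b) = b := u.apply_symm_apply b
    have := hval a
    have := hval (u.symm b)
    simp only at h1 h2 hm
    have hab : (a < q + 1 ∧ b = 0) ∨ (a = q + 2 ∧ b = q + 2) := by omega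
    rcases hab with ⟨ha, rfl⟩ | ⟨rfl, rfl⟩
    · rw [if_neg (hsh 0 (by omega))] at hm
      rw [stretchCol_of_unshaded fun i hi => absurd hi (by omega)]
      simp
      omega
    · rw [if_pos hs2] at hm
      rw [stretchCol_of_unshaded hsh]
      simp
      omega
  refine (Set.ncard_le_ncard hsub (Finset.finite_toSet _)).trans ?_
  rw [Set.ncard_coe_finset]
  refine (Finset.card_union_le _ _).trans ?_
  simp

theorem isBitScale_swap_ncard_le {N : ℕ} {v' : Equiv.Perm ℕ}
    (h : IsBitScale (q + 2) N (Equiv.swap q (q + 1)) v') : (rothe v').ncard ≤ 1 := by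
  have hsh : ∀ j < q + 2, j ∉ shadedCols (q + 2) (Equiv.swap q (q + 1)) := by
    rintro j hj ⟨r, hr, rfl⟩
    rw [Equiv.swap_apply_of_ne_of_ne (by omega) (by omega)] at hj
    omega
  have hsub : rothe v' ⊆ {(q, q)} := by
    rw [h.2]
    rintro _ ⟨⟨a, b⟩, ⟨h1, h2⟩, m, hm, rfl⟩
    rw [Equiv.symm_swap] at h2
    simp only [Equiv.swap_apply_def] at h1 h2
    have hab : a = q ∧ b = q := by
      split_ifs at h1 h2 <;> omega
    obtain ⟨rfl, rfl⟩ := hab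
    rw [if_neg (hsh _ (by simp))] at hm
    rw [stretchCol_of_unshaded fun i hi => hsh i (by simp only at hi; omega)]
    simp
    omega
  exact (Set.ncard_le_ncard hsub (Set.finite_singleton _)).trans (Set.ncard_singleton _).le

theorem isBitScale_right_ncard (hw1 : ∀ m < q, w m = m + 1) (hw2 : w q = q + 2)
    (hw3 : w (q + 1) = 0) (hw4 : w (q + 2) = q + 3) (hw5 : w (q + 3) = q + 1)
    (hw6 : InSymm (q + 4) w) {N : ℕ} {w' : Equiv.Perm ℕ} (h : IsBitScale (q + 2) N w w') :
    (rothe w').ncard = q + 1 + 2 * N := by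
  have hval := right_apply_cases hw1 hw2 hw3 hw4 hw5 hw6
  have hsh : ∀ j < q + 1, j ∉ shadedCols (q + 2) w := by
    rintro j hj ⟨r, hr, rfl⟩
    have := hval r
    omega
  have hs1 : q + 1 ∈ shadedCols (q + 2) w := ⟨q + 3, by omega, hw5⟩
  have hst : stretchCol (q + 2) N w (q + 1) = q + 1 := stretchCol_of_unshaded hsh
  have hst0 : stretchCol (q + 2) N w 0 = 0 :=
    stretchCol_of_unshaded fun i hi => absurd hi (by omega)
  have hmem : ∀ a b, (a, b) ∈ rothe w ↔
      (a < q + 1 ∧ b = 0) ∨ ((a = q ∨ a = q + 2) ∧ b = q + 1) := by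
    intro a b
    have hb : w (w.symm b) = b := w.apply_symm_apply b
    have := hval a
    have := hval (w.symm b)
    change (b < w a ∧ a < w.symm b) ↔ _
    omega
  have heq : rothe w' = ↑((Finset.range (q + 1) ×ˢ {0}) ∪
      (({q, q + 2} : Finset ℕ) ×ˢ Finset.Ico (q + 1) (q + 1 + N)) : Finset (ℕ × ℕ)) := by
    rw [h.2]
    ext ⟨a, b⟩
    simp only [Set.mem_ofPred_eq, Prod.exists, hmem, Prod.mk.injEq, Finset.coe_union, Set.mem_union,
      Finset.mem_coe, Finset.mem_product, Finset.mem_range, Finset.mem_singleton,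
      Finset.mem_insert, Finset.mem_Ico]
    constructor
    · rintro ⟨c, d, ⟨hc, rfl⟩ | ⟨hc, rfl⟩, m, hm, rfl, rfl⟩
      · rw [if_neg (hsh 0 (by omega))] at hm
        rw [hst0]
        omega
      · rw [if_pos hs1] at hm
        rw [hst]
        omega
    · rintro (⟨ha, rfl⟩ | ⟨ha, hb⟩)
      · refine ⟨a, 0, Or.inl ⟨ha, rfl⟩, 0, ?_, rfl, ?_⟩
        · rw [if_neg (hsh 0 (by omega))]
          omega
        · rw [hst0]
      · refine ⟨a, q + 1, Or.inr ⟨ha, rfl⟩, b - (q + 1), ?_, rfl, ?_⟩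
        · rw [if_pos hs1]
          omega
        · rw [hst]
          omega
  rw [heq, Set.ncard_coe_finset, Finset.card_union_of_disjoint]
  · rw [Finset.card_product, Finset.card_product, Finset.card_pair (by omega)]
    simp
  · rw [Finset.disjoint_left]
    rintro ⟨a, b⟩ h1 h2
    simp only [Finset.mem_product, Finset.mem_singleton, Finset.mem_Ico] at h1 h2
    omega

end Counterexample

end SchubertScaling

/-- Corollary 4.3: explicit counterexamples to saturation under bit scaling, for
`u = (2,3,…,n−2,1,n,n−1)`, `v = s_{n−3}`, `w = (2,…,n−3,n−1,1,n,n−2)` (0-indexed below),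
with bit scaling w.r.t. `k = n−1` (0-indexed: `n−2`). -/
theorem bit_scaling_counterexample
    (n : ℕ) (hn : 4 ≤ n) (u w : Equiv.Perm ℕ)
    (hu1 : ∀ m, m + 4 ≤ n → u m = m + 1)
    (hu2 : u (n - 3) = 0) (hu3 : u (n - 2) = n - 1) (hu4 : u (n - 1) = n - 2)
    (hu5 : InSymm n u)
    (hw1 : ∀ m, m + 5 ≤ n → w m = m + 1)
    (hw2 : w (n - 4) = n - 2) (hw3 : w (n - 3) = 0) (hw4 : w (n - 2) = n - 1)
    (hw5 : w (n - 1) = n - 3) (hw6 : InSymm n w) :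
    (∀ c : Equiv.Perm ℕ →₀ ℕ, IsSchubertCoeff u (Equiv.swap (n - 4) (n - 3)) c →
      c w = 1) ∧
    (∀ N : ℕ, 1 < N → ∀ u' v' w' : Equiv.Perm ℕ,
      IsBitScale (n - 2) N u u' → IsBitScale (n - 2) N (Equiv.swap (n - 4) (n - 3)) v' →
      IsBitScale (n - 2) N w w' →
      ∀ c : Equiv.Perm ℕ →₀ ℕ, IsSchubertCoeff u' v' c → c w' = 0) := by
  obtain ⟨q, rfl⟩ : ∃ q, n = q + 4 := ⟨n - 4, by omega⟩
  simp only [Nat.add_sub_cancel, Nat.reduceSubDiff] at *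
  have hu1' : ∀ m ≤ q, u m = m + 1 := fun m hm => hu1 m (by omega)
  have hw1' : ∀ m < q, w m = m + 1 := fun m hm => hw1 m (by omega)
  refine ⟨fun c hc =>
    SchubertScaling.coeff_eq_one hu1' hu2 hu3 hu4 hu5 hw1' hw2 hw3 hw4 hw5 hw6 hc, ?_⟩
  intro N hN u' v' w' hu' hv' hw' c hc
  refine SchubertScaling.coeff_eq_zero_of_ncard_rothe_ne hu'.1 hv'.1 hw'.1 ?_ hc
  have h1 := SchubertScaling.isBitScale_left_ncard_le hu1' hu2 hu3 hu4 hu5 hu'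
  have h2 := SchubertScaling.isBitScale_swap_ncard_le hv'
  have h3 := SchubertScaling.isBitScale_right_ncard hw1' hw2 hw3 hw4 hw5 hw6 hw'
  omega
end

section
/- (Monk's rule) Let u ∈ S_n and let 1 ≤ k ≤ n−1. Then 𝔖_u · 𝔖_{s_k} = Σ 𝔖_{u·t_{ij}}, where the sum is over all pairs i ≤ k < j such that u ⋖ u·t_{ij} is a cover in strong Bruhat order. -/
open scoped Classical

open MvPolynomial

/-! ### Divided differences -/

theorem X_sub_X_succ_ne_zero (i : ℕ) : (X i - X (i + 1) : MvPolynomial ℕ ℤ) ≠ 0 :=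
  sub_ne_zero.2 fun h => by simpa using X_injective h

theorem X_sub_X_succ_dvd (i : ℕ) (f : MvPolynomial ℕ ℤ) :
    (X i - X (i + 1) : MvPolynomial ℕ ℤ) ∣ f - rename (Equiv.swap i (i + 1)) f := by
  induction f using MvPolynomial.induction_on with
  | C a => simp
  | add p q hp hq =>
    have := dvd_add hp hq
    rw [map_add]
    convert this using 1
    ring
  | mul_X p j hp =>
    have hX : (X i - X (i + 1) : MvPolynomial ℕ ℤ) ∣ X j - X (Equiv.swap i (i + 1) j) := by
      rcases eq_or_ne j i with rfl | h1
      · simp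
      rcases eq_or_ne j (i + 1) with rfl | h2
      · rw [Equiv.swap_apply_right]
        exact ⟨-1, by ring⟩
      · simp [Equiv.swap_apply_of_ne_of_ne h1 h2]
    have := dvd_add (hp.mul_right (X j)) (hX.mul_left (rename (Equiv.swap i (i + 1)) p))
    rw [map_mul, rename_X]
    convert this using 1
    ring

theorem X_sub_X_succ_mul_divDiff (i : ℕ) (f : MvPolynomial ℕ ℤ) :
    (X i - X (i + 1)) * divDiff i f = f - rename (Equiv.swap i (i + 1)) f := by
  have h : ∃ g, f - rename (Equiv.swap i (i + 1)) f = (X i - X (i + 1)) * g := X_sub_X_succ_dvd i f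
  rw [divDiff, dif_pos h]
  exact (Exists.choose_spec h).symm

theorem divDiff_eq_of_mul_eq {i : ℕ} {f g : MvPolynomial ℕ ℤ}
    (h : (X i - X (i + 1)) * g = f - rename (Equiv.swap i (i + 1)) f) : divDiff i f = g :=
  mul_left_cancel₀ (X_sub_X_succ_ne_zero i) ((X_sub_X_succ_mul_divDiff i f).trans h.symm)

theorem divDiff_add (i : ℕ) (f g : MvPolynomial ℕ ℤ) :
    divDiff i (f + g) = divDiff i f + divDiff i g :=
  divDiff_eq_of_mul_eq (by
    rw [map_add]
    linear_combination X_sub_X_succ_mul_divDiff i f + X_sub_X_succ_mul_divDiff i g)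

theorem divDiff_eq_zero_iff {i : ℕ} {f : MvPolynomial ℕ ℤ} :
    divDiff i f = 0 ↔ rename (Equiv.swap i (i + 1)) f = f := by
  refine ⟨fun h => ?_, fun h => divDiff_eq_of_mul_eq (by rw [h]; ring)⟩
  have := X_sub_X_succ_mul_divDiff i f
  rw [h] at this
  linear_combination this

/-- The divided difference operator as an additive homomorphism. -/
noncomputable def divDiffHom (i : ℕ) : MvPolynomial ℕ ℤ →+ MvPolynomial ℕ ℤ where
  toFun := divDiff i
  map_zero' := divDiff_eq_zero_iff.2 (map_zero _)
  map_add' := divDiff_add i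

theorem divDiffHom_apply (i : ℕ) (f : MvPolynomial ℕ ℤ) : divDiffHom i f = divDiff i f := rfl

/-- The twisted Leibniz rule for divided differences. -/
theorem divDiff_mul (i : ℕ) (f g : MvPolynomial ℕ ℤ) :
    divDiff i (f * g) = divDiff i f * g + rename (Equiv.swap i (i + 1)) f * divDiff i g :=
  divDiff_eq_of_mul_eq (by
    rw [map_mul]
    linear_combination g * X_sub_X_succ_mul_divDiff i f +
      rename (Equiv.swap i (i + 1)) f * X_sub_X_succ_mul_divDiff i g)

theorem rename_swap_rename_swap (a b : ℕ) (f : MvPolynomial ℕ ℤ) :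
    rename (Equiv.swap a b) (rename (Equiv.swap a b) f) = f := by
  rw [rename_rename]
  convert rename_id_apply f
  ext x
  simp

theorem rename_swap_divDiff (i : ℕ) (f : MvPolynomial ℕ ℤ) :
    rename (Equiv.swap i (i + 1)) (divDiff i f) = divDiff i f := by
  refine (divDiff_eq_of_mul_eq ?_).symm
  have := congrArg (rename (Equiv.swap i (i + 1))) (X_sub_X_succ_mul_divDiff i f)
  simp only [map_mul, map_sub, rename_X, Equiv.swap_apply_left, Equiv.swap_apply_right,
    rename_swap_rename_swap] at this
  linear_combination -this

theorem divDiff_divDiff (i : ℕ) (f : MvPolynomial ℕ ℤ) : divDiff i (divDiff i f) = 0 :=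
  divDiff_eq_zero_iff.2 (rename_swap_divDiff i f)

theorem divDiff_comm {i j : ℕ} (h : i + 1 < j) (f : MvPolynomial ℕ ℤ) :
    divDiff i (divDiff j f) = divDiff j (divDiff i f) := by
  have h1 : (Equiv.swap i (i + 1)) j = j := Equiv.swap_apply_of_ne_of_ne (by omega) (by omega)
  have h2 : (Equiv.swap i (i + 1)) (j + 1) = j + 1 :=
    Equiv.swap_apply_of_ne_of_ne (by omega) (by omega)
  have h3 : (Equiv.swap j (j + 1)) i = i := Equiv.swap_apply_of_ne_of_ne (by omega) (by omega)
  have h4 : (Equiv.swap j (j + 1)) (i + 1) = i + 1 :=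
    Equiv.swap_apply_of_ne_of_ne (by omega) (by omega)
  have hc : rename (Equiv.swap i (i + 1)) (rename (Equiv.swap j (j + 1)) f) =
      rename (Equiv.swap j (j + 1)) (rename (Equiv.swap i (i + 1)) f) := by
    rw [rename_rename, rename_rename]
    congr 1
    rw [← Equiv.Perm.coe_mul, ← Equiv.Perm.coe_mul, Equiv.mul_swap_eq_swap_mul, h1, h2]
  have e1 := X_sub_X_succ_mul_divDiff i f
  have e2 := X_sub_X_succ_mul_divDiff j f
  have e3 := X_sub_X_succ_mul_divDiff j (divDiff i f)
  have e5 := congrArg (rename (Equiv.swap j (j + 1))) e1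
  have e6 := congrArg (rename (Equiv.swap i (i + 1))) e2
  simp only [map_mul, map_sub, rename_X, h1, h2, h3, h4] at e5 e6
  apply divDiff_eq_of_mul_eq
  apply mul_left_cancel₀ (X_sub_X_succ_ne_zero j)
  linear_combination (X i - X (i + 1)) * e3 + e1 - e5 - e2 + e6 - hc

theorem divDiff_braid (i : ℕ) (f : MvPolynomial ℕ ℤ) :
    divDiff i (divDiff (i + 1) (divDiff i f)) =
      divDiff (i + 1) (divDiff i (divDiff (i + 1) f)) := by
  have s1 : Equiv.swap i (i + 1) (i + 1 + 1) = i + 1 + 1 :=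
    Equiv.swap_apply_of_ne_of_ne (by omega) (by omega)
  have s2 : Equiv.swap (i + 1) (i + 1 + 1) i = i :=
    Equiv.swap_apply_of_ne_of_ne (by omega) (by omega)
  have hb : rename (Equiv.swap i (i + 1)) (rename (Equiv.swap (i + 1) (i + 1 + 1))
      (rename (Equiv.swap i (i + 1)) f)) = rename (Equiv.swap (i + 1) (i + 1 + 1))
      (rename (Equiv.swap i (i + 1)) (rename (Equiv.swap (i + 1) (i + 1 + 1)) f)) := by
    simp only [rename_rename]
    congr 2
    funext x
    simp only [Function.comp_apply, Equiv.swap_apply_def]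
    split_ifs <;> omega
  have hne : (X i - X (i + 1 + 1) : MvPolynomial ℕ ℤ) ≠ 0 :=
    sub_ne_zero.2 fun h => by have := X_injective h; omega
  have a1 := X_sub_X_succ_mul_divDiff i f
  have a2 := X_sub_X_succ_mul_divDiff (i + 1) (divDiff i f)
  have a3 := X_sub_X_succ_mul_divDiff i (divDiff (i + 1) (divDiff i f))
  have b1 := X_sub_X_succ_mul_divDiff (i + 1) f
  have b2 := X_sub_X_succ_mul_divDiff i (divDiff (i + 1) f)
  have b3 := X_sub_X_succ_mul_divDiff (i + 1) (divDiff i (divDiff (i + 1) f))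
  have a4 := congrArg (rename (Equiv.swap i (i + 1))) a2
  have a5 := congrArg (rename (Equiv.swap (i + 1) (i + 1 + 1))) a1
  have b4 := congrArg (rename (Equiv.swap (i + 1) (i + 1 + 1))) b2
  have b5 := congrArg (rename (Equiv.swap i (i + 1))) b1
  have a6 := congrArg (rename (Equiv.swap i (i + 1))) a5
  have b6 := congrArg (rename (Equiv.swap (i + 1) (i + 1 + 1))) b5
  have a7 := rename_swap_divDiff i f
  have b7 := rename_swap_divDiff (i + 1) f
  simp only [map_mul, map_sub, rename_X, Equiv.swap_apply_left, Equiv.swap_apply_right, s1, s2]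
    at a4 a5 b4 b5 a6 b6
  rw [a7] at a4
  rw [b7] at b4
  apply mul_left_cancel₀ (X_sub_X_succ_ne_zero i)
  apply mul_left_cancel₀ (X_sub_X_succ_ne_zero (i + 1))
  apply mul_left_cancel₀ hne
  linear_combination (X (i + 1) - X (i + 1 + 1)) * (X i - X (i + 1 + 1)) * a3
    + (X i - X (i + 1 + 1)) * a2 - (X (i + 1) - X (i + 1 + 1)) * a4 + a1 - a5 + a6
    - ((X i - X (i + 1)) * (X i - X (i + 1 + 1)) * b3
    + (X i - X (i + 1 + 1)) * b2 - (X i - X (i + 1)) * b4 + b1 - b5 + b6) - hb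

theorem isHomogeneous_divDiff (i d : ℕ) {f : MvPolynomial ℕ ℤ} (hf : f.IsHomogeneous (d + 1)) :
    (divDiff i f).IsHomogeneous d := by
  have hx : (X i - X (i + 1) : MvPolynomial ℕ ℤ).IsHomogeneous 1 :=
    (isHomogeneous_X _ _).sub (isHomogeneous_X _ _)
  have key : divDiff i f = homogeneousComponent d (divDiff i f) := by
    apply mul_left_cancel₀ (X_sub_X_succ_ne_zero i)
    have h1 : ((X i - X (i + 1)) * divDiff i f).IsHomogeneous (d + 1) := by
      rw [X_sub_X_succ_mul_divDiff]
      exact hf.sub (hf.rename_isHomogeneous)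
    rw [← homogeneousComponent_eq_self h1]
    let _ : GradedAlgebra (homogeneousSubmodule ℕ ℤ) := gradedAlgebra
    have hdec : ∀ (φ : MvPolynomial ℕ ℤ) (m : ℕ),
        (DirectSum.decompose (homogeneousSubmodule ℕ ℤ) φ m : MvPolynomial ℕ ℤ) =
          homogeneousComponent m φ := decomposition.decompose'_apply
    have := DirectSum.coe_decompose_mul_add_of_left_mem (homogeneousSubmodule ℕ ℤ) (i := 1)
      (j := d) (b := divDiff i f) hx
    rwa [hdec, hdec, add_comm] at this
  rw [key]
  exact homogeneousComponent_isHomogeneous _ _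

theorem exists_eq_C_of_divDiff_eq_zero {f : MvPolynomial ℕ ℤ} (h : ∀ i, divDiff i f = 0) :
    ∃ a, f = C a := by
  have hstep : ∀ j ∈ f.vars, j + 1 ∈ f.vars := by
    intro j hj
    rw [← divDiff_eq_zero_iff.1 (h j)] at hj
    obtain ⟨i, hi, hij⟩ := mem_vars_rename _ _ hj
    rw [Equiv.swap_apply_eq_iff, Equiv.swap_apply_left] at hij
    exact hij ▸ hi
  have hvars : f.vars = ∅ := by
    by_contra hne
    have hne := Finset.nonempty_iff_ne_empty.2 hne
    have := Finset.le_max' _ _ (hstep _ (f.vars.max'_mem hne))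
    omega
  exact ⟨_, vars_eq_empty_iff_eq_C.1 hvars⟩

theorem eq_zero_of_divDiff_eq_zero {f : MvPolynomial ℕ ℤ} {d : ℕ} (hd : d ≠ 0)
    (hf : f.IsHomogeneous d) (h : ∀ i, divDiff i f = 0) : f = 0 := by
  obtain ⟨a, rfl⟩ := exists_eq_C_of_divDiff_eq_zero h
  by_contra hne
  exact hd (hf.inj_right (isHomogeneous_C _ a) hne)

/-! ### Finitely supported permutations and lengths -/

theorem InSymm.lt {n : ℕ} {w : Equiv.Perm ℕ} (hw : InSymm n w) {m : ℕ} (hm : m < n) :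
    w m < n := by
  by_contra! h
  have := w.injective (hw _ h)
  omega

theorem InSymm.mono {n m : ℕ} {w : Equiv.Perm ℕ} (hw : InSymm n w) (h : n ≤ m) : InSymm m w :=
  fun _ hj => hw _ (h.trans hj)

theorem InSymm.mul_swap {n a b : ℕ} {w : Equiv.Perm ℕ} (hw : InSymm n w) (ha : a < n)
    (hb : b < n) : InSymm n (w * Equiv.swap a b) := fun m hm => by
  rw [Equiv.Perm.mul_apply, Equiv.swap_apply_of_ne_of_ne (by omega) (by omega), hw m hm]

theorem IsFinPerm.mul_swap {w : Equiv.Perm ℕ} (hw : IsFinPerm w) (a b : ℕ) :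
    IsFinPerm (w * Equiv.swap a b) := by
  obtain ⟨n, hn⟩ := hw
  exact ⟨n + a + b + 1, (hn.mono (by omega)).mul_swap (by omega) (by omega)⟩

theorem InSymm.inversions_subset {n : ℕ} {w : Equiv.Perm ℕ} (hw : InSymm n w) :
    {p : ℕ × ℕ | p.1 < p.2 ∧ w p.2 < w p.1} ⊆ (Finset.range n ×ˢ Finset.range n : Finset (ℕ × ℕ)) := by
  rintro ⟨a, b⟩ ⟨h1, h2⟩
  dsimp only at h1 h2
  have hb : b < n := by
    by_contra! hb
    rw [hw b hb] at h2
    rcases lt_or_ge a n with ha | ha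
    · have := hw.lt ha
      omega
    · rw [hw a ha] at h2
      omega
  simp only [Finset.coe_product, Finset.coe_range, Set.mem_prod, Set.mem_Iio]
  omega

theorem IsFinPerm.finite_inversions {w : Equiv.Perm ℕ} (hw : IsFinPerm w) :
    {p : ℕ × ℕ | p.1 < p.2 ∧ w p.2 < w p.1}.Finite := by
  obtain ⟨n, hn⟩ := hw
  exact (Finset.finite_toSet _).subset hn.inversions_subset

theorem swap_mul_swap_mul_swap_comm {a b c : ℕ} (hbc : b ≠ c) (hba : b ≠ a) :
    Equiv.swap a c * (Equiv.swap c b * Equiv.swap a c) = Equiv.swap a b := by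
  rw [Equiv.swap_comm a c, Equiv.swap_comm c b, ← mul_assoc]
  exact Equiv.swap_mul_swap_mul_swap hbc hba

theorem mul_swap_mul_swap_self (w : Equiv.Perm ℕ) (a b : ℕ) :
    w * Equiv.swap a b * Equiv.swap a b = w := by
  rw [mul_assoc, Equiv.swap_mul_self, mul_one]

theorem mul_swap_mul_swap_apply (w : Equiv.Perm ℕ) (i j a b : ℕ) :
    w * Equiv.swap i j * Equiv.swap (Equiv.swap i j a) (Equiv.swap i j b) =
      w * Equiv.swap a b * Equiv.swap i j := by
  rw [mul_assoc, Equiv.mul_swap_eq_swap_mul, ← mul_assoc]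
  simp

theorem InSymm.invLen_le {n : ℕ} {w : Equiv.Perm ℕ} (hw : InSymm n w) : invLen w ≤ n * n := by
  refine (Set.ncard_le_ncard hw.inversions_subset (Finset.finite_toSet _)).trans ?_
  simp

theorem invLen_mul_swap_succ {w : Equiv.Perm ℕ} (hw : IsFinPerm w) {i : ℕ}
    (h : w i < w (i + 1)) : invLen (w * Equiv.swap i (i + 1)) = invLen w + 1 := by
  have hset : {p : ℕ × ℕ | p.1 < p.2 ∧ (w * Equiv.swap i (i + 1)) p.2 <
      (w * Equiv.swap i (i + 1)) p.1} = insert (i, i + 1)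
      (Prod.map (Equiv.swap i (i + 1)) (Equiv.swap i (i + 1)) ''
        {p : ℕ × ℕ | p.1 < p.2 ∧ w p.2 < w p.1}) := by
    ext ⟨a, b⟩
    simp only [Set.mem_ofPred_eq, Equiv.Perm.mul_apply, Set.mem_insert_iff, Prod.mk.injEq,
      Set.mem_image, Prod.exists, Prod.map_apply]
    constructor
    · rintro ⟨h1, h2⟩
      by_cases hab : a = i ∧ b = i + 1
      · exact Or.inl hab
      · refine Or.inr ⟨_, _, ⟨?_, h2⟩, by simp, by simp⟩
        simp only [Equiv.swap_apply_def]
        split_ifs <;> omega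
    · rintro (⟨rfl, rfl⟩ | ⟨c, d, ⟨h1, h2⟩, rfl, rfl⟩)
      · simpa using h
      · refine ⟨?_, by simpa using h2⟩
        have hcd : ¬(c = i ∧ d = i + 1) := by
          rintro ⟨rfl, rfl⟩
          omega
        simp only [Equiv.swap_apply_def]
        split_ifs <;> omega
  have hfin := hw.finite_inversions
  rw [invLen, hset, Set.ncard_insert_of_notMem _ (hfin.image _), Set.ncard_image_of_injective, invLen]
  · exact (Equiv.injective _).prodMap (Equiv.injective _)
  · rintro ⟨⟨c, d⟩, ⟨h1, h2⟩, hcd⟩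
    simp only [Prod.map_apply, Prod.mk.injEq, Equiv.swap_apply_eq_iff, Equiv.swap_apply_left,
      Equiv.swap_apply_right] at hcd h1
    omega

theorem invLen_mul_swap_succ_of_gt {w : Equiv.Perm ℕ} (hw : IsFinPerm w) {i : ℕ}
    (h : w (i + 1) < w i) : invLen w = invLen (w * Equiv.swap i (i + 1)) + 1 := by
  have := invLen_mul_swap_succ (hw.mul_swap i (i + 1)) (i := i) (by simpa using h)
  rwa [mul_assoc, Equiv.swap_mul_self, mul_one] at this

theorem invLen_lt_mul_swap {w : Equiv.Perm ℕ} (hw : IsFinPerm w) {a b : ℕ} (hab : a < b)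
    (h : w a < w b) : invLen w < invLen (w * Equiv.swap a b) := by
  induction hd : b - a using Nat.strong_induction_on generalizing a w with
  | _ d ih =>
    rcases eq_or_lt_of_le (Nat.succ_le_of_lt hab) with rfl | hab'
    · rw [Nat.succ_eq_add_one, invLen_mul_swap_succ hw h]
      omega
    have hb : Equiv.swap a (a + 1) b = b := Equiv.swap_apply_of_ne_of_ne (by omega) (by omega)
    have ha : Equiv.swap (a + 1) b a = a := Equiv.swap_apply_of_ne_of_ne (by omega) (by omega)
    have hfin := hw.mul_swap a (a + 1)
    have step := ih (b - (a + 1)) (by omega) hfin (a := a + 1) (by omega)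
      (by simpa [hb] using h) rfl
    have hconj : w * Equiv.swap a b = w * Equiv.swap a (a + 1) * Equiv.swap (a + 1) b *
        Equiv.swap a (a + 1) := by
      simp only [mul_assoc, swap_mul_swap_mul_swap_comm (show b ≠ a + 1 by omega)
        (show b ≠ a by omega)]
    have e1 : (w * Equiv.swap a (a + 1) * Equiv.swap (a + 1) b) a = w (a + 1) := by simp [ha]
    have e2 : (w * Equiv.swap a (a + 1) * Equiv.swap (a + 1) b) (a + 1) = w b := by simp [hb]
    have hne : w a ≠ w (a + 1) := fun h => by simpa using w.injective h
    have hne' : w (a + 1) ≠ w b := fun h => by have := w.injective h; omega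
    rw [hconj]
    rcases lt_or_gt_of_ne hne' with h2 | h2
    · have := invLen_mul_swap_succ (hfin.mul_swap (a + 1) b) (i := a) (by rwa [e1, e2])
      rcases lt_or_gt_of_ne hne with h1 | h1
      · have := invLen_mul_swap_succ hw h1
        omega
      · have := invLen_mul_swap_succ_of_gt hw h1
        omega
    · have := invLen_mul_swap_succ_of_gt (hfin.mul_swap (a + 1) b) (i := a) (by rwa [e1, e2])
      have := invLen_mul_swap_succ hw (i := a) (by omega)
      omega

theorem lt_of_invLen_lt_mul_swap {w : Equiv.Perm ℕ} (hw : IsFinPerm w) {a b : ℕ} (hab : a < b)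
    (h : invLen w < invLen (w * Equiv.swap a b)) : w a < w b := by
  by_contra! hle
  have hlt : w b < w a := lt_of_le_of_ne hle fun h => by have := w.injective h; omega
  have := invLen_lt_mul_swap (hw.mul_swap a b) hab (by simpa using hlt)
  rw [mul_swap_mul_swap_self] at this
  omega

theorem invLen_add_two_le_mul_swap {w : Equiv.Perm ℕ} (hw : IsFinPerm w) {a b c : ℕ} (hac : a < c)
    (hcb : c < b) (h1 : w a < w c) (h2 : w c < w b) :
    invLen w + 2 ≤ invLen (w * Equiv.swap a b) := by
  have hb : Equiv.swap a c b = b := Equiv.swap_apply_of_ne_of_ne (by omega) (by omega)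
  have ha : Equiv.swap c b a = a := Equiv.swap_apply_of_ne_of_ne (by omega) (by omega)
  have hconj : w * Equiv.swap a b = w * Equiv.swap a c * Equiv.swap c b * Equiv.swap a c := by
    simp only [mul_assoc, swap_mul_swap_mul_swap_comm (show b ≠ c by omega) (show b ≠ a by omega)]
  have s1 := invLen_lt_mul_swap hw hac h1
  have s2 := invLen_lt_mul_swap (hw.mul_swap a c) hcb (by simpa [hb] using h1.trans h2)
  have s3 := invLen_lt_mul_swap ((hw.mul_swap a c).mul_swap c b) hac (by simpa [ha, hb] using h2)
  rw [hconj]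
  omega

theorem InSymm.le_of_cover {n a b : ℕ} {w : Equiv.Perm ℕ} (hw : InSymm n w)
    (h : invLen (w * Equiv.swap a b) = invLen w + 1) : b ≤ max n (a + 1) := by
  by_contra! hb
  rw [max_lt_iff] at hb
  have hwb : w b = b := hw b hb.1.le
  have hfin : IsFinPerm w := ⟨n, hw⟩
  rcases lt_or_ge a n with ha | ha
  · have := hw.lt ha
    have hn := hw n le_rfl
    have := invLen_add_two_le_mul_swap hfin ha hb.1 (by omega) (by omega)
    omega
  · have h1 := hw a ha
    have h2 := hw (a + 1) (by omega)
    have := invLen_add_two_le_mul_swap hfin (a := a) (b := b) (c := a + 1) (by omega) hb.2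
      (by omega) (by omega)
    omega

/-- The only cover that turns an ascent at `i` into a descent at `i` is `w ⋖ w·sᵢ`. -/
theorem eq_of_cover_of_ascent_of_descent {w : Equiv.Perm ℕ} (hw : IsFinPerm w) {i a b : ℕ}
    (hab : a < b) (hcov : invLen (w * Equiv.swap a b) = invLen w + 1) (h1 : w i < w (i + 1))
    (h2 : (w * Equiv.swap a b) (i + 1) < (w * Equiv.swap a b) i) : a = i ∧ b = i + 1 := by
  by_contra hne
  have hlt := lt_of_invLen_lt_mul_swap hw hab (by omega)
  have l1 := invLen_mul_swap_succ hw h1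
  have l2 := invLen_mul_swap_succ_of_gt (hw.mul_swap a b) h2
  have hab' : Equiv.swap i (i + 1) a < Equiv.swap i (i + 1) b := by
    simp only [Equiv.swap_apply_def]
    split_ifs <;> omega
  have := invLen_lt_mul_swap (hw.mul_swap i (i + 1)) hab' (by simpa using hlt)
  rw [mul_swap_mul_swap_apply] at this
  omega

/-! ### Schubert polynomials -/

theorem not_ascent_of_le_invLen {n : ℕ} {w : Equiv.Perm ℕ} (hw : InSymm n w)
    (h : n * n ≤ invLen w) : ¬∃ i, i + 1 < n ∧ w i < w (i + 1) := by
  rintro ⟨i, hi, hlt⟩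
  have := invLen_mul_swap_succ ⟨n, hw⟩ hlt
  have := (hw.mul_swap (Nat.lt_of_succ_lt hi) hi).invLen_le
  omega

theorem SchubertAux_of_not_ascent {n : ℕ} {w : Equiv.Perm ℕ}
    (h : ¬∃ i, i + 1 < n ∧ w i < w (i + 1)) (f : ℕ) : SchubertAux n f w = staircase n := by
  cases f with
  | zero => rfl
  | succ f => rw [SchubertAux, dif_neg h]

theorem SchubertAux_congr_fuel {n f f' : ℕ} {w : Equiv.Perm ℕ} (hw : InSymm n w)
    (hf : n * n ≤ invLen w + f) (hf' : n * n ≤ invLen w + f') :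
    SchubertAux n f w = SchubertAux n f' w := by
  induction f generalizing f' w with
  | zero =>
    have h := not_ascent_of_le_invLen hw hf
    rw [SchubertAux_of_not_ascent h, SchubertAux_of_not_ascent h]
  | succ f ih =>
    by_cases h : ∃ i, i + 1 < n ∧ w i < w (i + 1)
    · cases f' with
      | zero => exact absurd h (not_ascent_of_le_invLen hw hf')
      | succ f' =>
        rw [SchubertAux, SchubertAux, dif_pos h, dif_pos h]
        have hlen := invLen_mul_swap_succ ⟨n, hw⟩ h.choose_spec.2
        rw [ih (f' := f') (hw.mul_swap (Nat.lt_of_succ_lt h.choose_spec.1) h.choose_spec.1)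
          (by omega) (by omega)]
    · rw [SchubertAux_of_not_ascent h, SchubertAux_of_not_ascent h]

/-- The Schubert polynomial of `w` computed inside `S_n`. -/
noncomputable def schubertIn (n : ℕ) (w : Equiv.Perm ℕ) : MvPolynomial ℕ ℤ :=
  SchubertAux n (n * n) w

theorem schubertIn_of_not_ascent {n : ℕ} {w : Equiv.Perm ℕ}
    (h : ¬∃ i, i + 1 < n ∧ w i < w (i + 1)) : schubertIn n w = staircase n :=
  SchubertAux_of_not_ascent h _

theorem exists_schubertIn_eq_divDiff {n : ℕ} {w : Equiv.Perm ℕ} (hw : InSymm n w)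
    (h : ∃ i, i + 1 < n ∧ w i < w (i + 1)) :
    ∃ i, i + 1 < n ∧ w i < w (i + 1) ∧
      schubertIn n w = divDiff i (schubertIn n (w * Equiv.swap i (i + 1))) := by
  refine ⟨h.choose, h.choose_spec.1, h.choose_spec.2, ?_⟩
  have hlen := invLen_mul_swap_succ ⟨n, hw⟩ h.choose_spec.2
  have hsymm := hw.mul_swap (Nat.lt_of_succ_lt h.choose_spec.1) h.choose_spec.1
  rw [schubertIn, SchubertAux_congr_fuel (f' := n * n + 1) hw (by omega) (by omega), SchubertAux,
    dif_pos h]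
  rfl

theorem schubertIn_eq_divDiff {n i : ℕ} {w : Equiv.Perm ℕ} (hw : InSymm n w) (hi : i + 1 < n)
    (h : w i < w (i + 1)) :
    schubertIn n w = divDiff i (schubertIn n (w * Equiv.swap i (i + 1))) := by
  induction hd : n * n - invLen w using Nat.strong_induction_on generalizing i w with
  | _ d ih =>
    have step : ∀ {v : Equiv.Perm ℕ} {j : ℕ}, InSymm n v → invLen w < invLen v → j + 1 < n →
        v j < v (j + 1) →
        schubertIn n v = divDiff j (schubertIn n (v * Equiv.swap j (j + 1))) := by
      intro v j hv hlt hj hasc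
      have := hv.invLen_le
      exact ih _ (by omega) hv hj hasc rfl
    have up : ∀ {v : Equiv.Perm ℕ} {j : ℕ}, InSymm n v → invLen w ≤ invLen v → j + 1 < n →
        v j < v (j + 1) → InSymm n (v * Equiv.swap j (j + 1)) ∧
          invLen w < invLen (v * Equiv.swap j (j + 1)) := by
      intro v j hv hle hj hasc
      have := invLen_mul_swap_succ ⟨n, hv⟩ hasc
      exact ⟨hv.mul_swap (by omega) hj, by omega⟩
    -- two ascents that are far apart
    have far : ∀ {a b : ℕ}, a + 1 < b → b + 1 < n → w a < w (a + 1) → w b < w (b + 1) →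
        divDiff a (schubertIn n (w * Equiv.swap a (a + 1))) =
          divDiff b (schubertIn n (w * Equiv.swap b (b + 1))) := by
      intro a b hab hb ha' hb'
      have e1 : Equiv.swap a (a + 1) b = b := Equiv.swap_apply_of_ne_of_ne (by omega) (by omega)
      have e2 : Equiv.swap a (a + 1) (b + 1) = b + 1 :=
        Equiv.swap_apply_of_ne_of_ne (by omega) (by omega)
      have e3 : Equiv.swap b (b + 1) a = a := Equiv.swap_apply_of_ne_of_ne (by omega) (by omega)
      have e4 : Equiv.swap b (b + 1) (a + 1) = a + 1 :=
        Equiv.swap_apply_of_ne_of_ne (by omega) (by omega)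
      obtain ⟨ua, la⟩ := up hw le_rfl (by omega) ha'
      obtain ⟨ub, lb⟩ := up hw le_rfl hb hb'
      rw [step ua la hb (by simpa [e1, e2] using hb'), step ub lb (j := a) (by omega)
        (by simpa [e3, e4] using ha'), divDiff_comm hab]
      have := mul_swap_mul_swap_apply w a (a + 1) b (b + 1)
      rw [e1, e2] at this
      rw [this]
    -- two adjacent ascents
    have near : ∀ {a : ℕ}, a + 1 + 1 < n → w a < w (a + 1) → w (a + 1) < w (a + 1 + 1) →
        divDiff a (schubertIn n (w * Equiv.swap a (a + 1))) =
          divDiff (a + 1) (schubertIn n (w * Equiv.swap (a + 1) (a + 1 + 1))) := by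
      intro a hb ha' hb'
      have e1 : Equiv.swap a (a + 1) (a + 1 + 1) = a + 1 + 1 :=
        Equiv.swap_apply_of_ne_of_ne (by omega) (by omega)
      have e2 : Equiv.swap (a + 1) (a + 1 + 1) a = a :=
        Equiv.swap_apply_of_ne_of_ne (by omega) (by omega)
      have hac := ha'.trans hb'
      obtain ⟨ua, la⟩ := up hw le_rfl (by omega) ha'
      obtain ⟨ub, lb⟩ := up hw le_rfl hb hb'
      have ha2 : (w * Equiv.swap a (a + 1)) (a + 1) < (w * Equiv.swap a (a + 1)) (a + 1 + 1) := by
        simpa [e1] using hac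
      have hb2 : (w * Equiv.swap (a + 1) (a + 1 + 1)) a <
          (w * Equiv.swap (a + 1) (a + 1 + 1)) (a + 1) := by
        simpa [e2] using hac
      obtain ⟨ua2, la2⟩ := up ua la.le hb ha2
      obtain ⟨ub2, lb2⟩ := up ub lb.le (by omega) hb2
      rw [step ua la hb ha2, step ub lb (by omega) hb2,
        step ua2 la2 (j := a) (by omega) (by simpa [e1, e2] using hb'),
        step ub2 lb2 (j := a + 1) hb (by simpa [e1, e2] using ha'), divDiff_braid]
      have h1 := swap_mul_swap_mul_swap_comm (a := a) (b := a + 1 + 1) (c := a + 1)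
        (by omega) (by omega)
      have h2 := swap_mul_swap_mul_swap_comm (a := a + 1 + 1) (b := a) (c := a + 1)
        (by omega) (by omega)
      rw [Equiv.swap_comm (a + 1 + 1) (a + 1), Equiv.swap_comm (a + 1) a,
        Equiv.swap_comm _ a] at h2
      simp only [mul_assoc, h1, h2]
    obtain ⟨c, hc, hcw, hceq⟩ := exists_schubertIn_eq_divDiff hw ⟨i, hi, h⟩
    rw [hceq]
    obtain hlt | rfl | rfl | rfl | hlt :
        c + 1 < i ∨ i = c + 1 ∨ i = c ∨ c = i + 1 ∨ i + 1 < c := by omega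
    · exact far hlt hi hcw h
    · exact near hi hcw h
    · rfl
    · exact (near hc h hcw).symm
    · exact (far hlt hc h hcw).symm

theorem apply_lt_of_not_ascent {n : ℕ} {w : Equiv.Perm ℕ}
    (h : ¬∃ i, i + 1 < n ∧ w i < w (i + 1)) {a b : ℕ} (hab : a < b) (hb : b < n) : w b < w a := by
  push Not at h
  have hstep : ∀ i, i + 1 < n → w (i + 1) < w i := fun i hi =>
    lt_of_le_of_ne (h i hi) fun h => by simpa using w.injective h
  induction b, hab using Nat.le_induction with
  | base => exact hstep a hb
  | succ b _ ih => exact (hstep b hb).trans (ih (by omega))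

/-- The Schubert polynomial of a permutation in `S_{n+1}` that has its largest value `n`
in position `j` and is decreasing elsewhere. -/
theorem schubertIn_succ_of_almost_decreasing {n j : ℕ} {v : Equiv.Perm ℕ}
    (hv : InSymm (n + 1) v) (hj : j ≤ n) (hvj : v j = n)
    (hdec : ∀ a b, a < b → b ≤ n → a ≠ j → b ≠ j → v b < v a) :
    schubertIn (n + 1) v =
      ∏ i ∈ Finset.range (n + 1), X i ^ (if i < j then n - 1 - i else n - i) := by
  induction j generalizing v with
  | zero =>
    rw [schubertIn_of_not_ascent]
    · simp [staircase]
    · rintro ⟨i, hi, hlt⟩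
      rcases Nat.eq_zero_or_pos i with rfl | hi0
      · have := hv.lt hi
        omega
      · have := hdec i (i + 1) (by omega) (by omega) (by omega) (by omega)
        omega
  | succ j ih =>
    have hvj' : v j < v (j + 1) := by
      have := hv.lt (show j < n + 1 by omega)
      have : v j ≠ v (j + 1) := fun h => by simpa using v.injective h
      omega
    rw [schubertIn_eq_divDiff hv (by omega) hvj',
      ih (hv.mul_swap (by omega) (by omega)) (by omega) (by simpa using hvj) ?_]
    · set P : MvPolynomial ℕ ℤ :=
        ∏ i ∈ Finset.range (n + 1), X i ^ (if i < j + 1 then n - 1 - i else n - i) with hP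
      have hPsymm : rename (Equiv.swap j (j + 1)) P = P := by
        rw [hP, map_prod]
        refine Finset.prod_equiv (Equiv.swap j (j + 1)) (fun i => ?_) (fun i _ => ?_)
        · simp only [Finset.mem_range, Equiv.swap_apply_def]
          split_ifs <;> omega
        · rw [map_pow, rename_X]
          congr 1
          simp only [Equiv.swap_apply_def]
          split_ifs <;> omega
      have hfac : (∏ i ∈ Finset.range (n + 1), X i ^ (if i < j then n - 1 - i else n - i) :
          MvPolynomial ℕ ℤ) = X j * P := by
        have hmem : j ∈ Finset.range (n + 1) := Finset.mem_range.2 (by omega)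
        rw [hP, ← Finset.mul_prod_erase _ _ hmem, ← Finset.mul_prod_erase _ _ hmem, ← mul_assoc]
        congr 1
        · rw [if_neg (lt_irrefl j), if_pos (Nat.lt_succ_self j), ← pow_succ']
          congr 1
          omega
        · refine Finset.prod_congr rfl fun i hi => ?_
          have := Finset.ne_of_mem_erase hi
          congr 1
          split_ifs <;> omega
      refine hfac ▸ divDiff_eq_of_mul_eq ?_
      rw [map_mul, rename_X, hPsymm, Equiv.swap_apply_left]
      ring
    · intro a b hab hb ha' hb'
      simp only [Equiv.Perm.mul_apply]
      refine hdec _ _ ?_ ?_ ?_ ?_ <;> simp only [Equiv.swap_apply_def] <;> split_ifs <;> omega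

theorem schubertIn_succ {n : ℕ} {w : Equiv.Perm ℕ} (hw : InSymm n w) :
    schubertIn (n + 1) w = schubertIn n w := by
  induction hd : n * n - invLen w using Nat.strong_induction_on generalizing w with
  | _ d ih =>
    by_cases h : ∃ i, i + 1 < n ∧ w i < w (i + 1)
    · obtain ⟨i, hi, hlt⟩ := h
      have hsymm := hw.mul_swap (Nat.lt_of_succ_lt hi) hi
      have := invLen_mul_swap_succ ⟨n, hw⟩ hlt
      have := hsymm.invLen_le
      rw [schubertIn_eq_divDiff hw hi hlt,
        schubertIn_eq_divDiff (hw.mono n.le_succ) (by omega) hlt, ih _ (by omega) hsymm rfl]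
    · rw [schubertIn_of_not_ascent h, schubertIn_succ_of_almost_decreasing (hw.mono n.le_succ) le_rfl
        (hw n le_rfl) fun a b hab hb _ _ => apply_lt_of_not_ascent h hab (by omega),
        Finset.prod_range_succ, staircase]
      simp only [lt_irrefl, if_false, Nat.sub_self, pow_zero, mul_one]
      exact Finset.prod_congr rfl fun i hi => by rw [if_pos (Finset.mem_range.1 hi)]

theorem schubertIn_mono {n m : ℕ} {w : Equiv.Perm ℕ} (hw : InSymm n w) (h : n ≤ m) :
    schubertIn m w = schubertIn n w := by
  induction m, h using Nat.le_induction with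
  | base => rfl
  | succ m hm ih => rw [schubertIn_succ (hw.mono hm), ih]

theorem Schubert_eq_schubertIn {n : ℕ} {w : Equiv.Perm ℕ} (hw : InSymm n w) :
    Schubert w = schubertIn n w := by
  have h : IsFinPerm w := ⟨n, hw⟩
  rw [Schubert, dif_pos h]
  change schubertIn h.choose w = _
  rw [← schubertIn_mono h.choose_spec (le_max_left _ n), schubertIn_mono hw (le_max_right _ _)]

theorem Schubert_one : Schubert 1 = 1 := by
  rw [Schubert_eq_schubertIn (n := 0) fun _ _ => rfl, schubertIn_of_not_ascent (by simp)]
  simp [staircase]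

theorem Schubert_eq_divDiff {w : Equiv.Perm ℕ} (hw : IsFinPerm w) {i : ℕ} (h : w i < w (i + 1)) :
    Schubert w = divDiff i (Schubert (w * Equiv.swap i (i + 1))) := by
  obtain ⟨n, hn⟩ := hw
  have hn' : InSymm (n + i + 2) w := hn.mono (by omega)
  rw [Schubert_eq_schubertIn hn', schubertIn_eq_divDiff hn' (by omega) h,
    Schubert_eq_schubertIn (hn'.mul_swap (by omega) (by omega))]

theorem divDiff_Schubert_of_ascent {w : Equiv.Perm ℕ} (hw : IsFinPerm w) {i : ℕ}
    (h : w i < w (i + 1)) : divDiff i (Schubert w) = 0 := by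
  rw [Schubert_eq_divDiff hw h, divDiff_divDiff]

theorem divDiff_Schubert_of_descent {w : Equiv.Perm ℕ} (hw : IsFinPerm w) {i : ℕ}
    (h : w (i + 1) < w i) : divDiff i (Schubert w) = Schubert (w * Equiv.swap i (i + 1)) := by
  rw [Schubert_eq_divDiff (hw.mul_swap i (i + 1)) (i := i) (by simpa using h),
    mul_swap_mul_swap_self]

theorem InSymm.invLen_of_not_ascent {n : ℕ} {w : Equiv.Perm ℕ} (hw : InSymm n w)
    (h : ¬∃ i, i + 1 < n ∧ w i < w (i + 1)) : invLen w = ∑ i ∈ Finset.range n, (n - 1 - i) := by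
  have hset : {p : ℕ × ℕ | p.1 < p.2 ∧ w p.2 < w p.1} =
      ((Finset.range n).sigma fun i => Finset.Ioo i n).map
        (Equiv.sigmaEquivProd ℕ ℕ).toEmbedding := by
    ext ⟨a, b⟩
    simp only [Set.mem_ofPred_eq, Finset.coe_map, Set.mem_image, Finset.mem_coe, Finset.mem_sigma,
      Finset.mem_range, Finset.mem_Ioo]
    constructor
    · intro hab
      have := hw.inversions_subset (a := (a, b)) hab
      simp only [Finset.coe_product, Finset.coe_range, Set.mem_prod, Set.mem_Iio] at this
      exact ⟨⟨a, b⟩, ⟨this.1, hab.1, this.2⟩, rfl⟩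
    · rintro ⟨⟨c, d⟩, ⟨-, h2, h3⟩, heq⟩
      obtain ⟨rfl, rfl⟩ := Prod.mk.inj heq
      exact ⟨h2, apply_lt_of_not_ascent h h2 h3⟩
  rw [invLen, hset, Set.ncard_coe_finset, Finset.card_map, Finset.card_sigma]
  refine Finset.sum_congr rfl fun i _ => ?_
  rw [Nat.card_Ioo]
  omega

theorem isHomogeneous_Schubert {w : Equiv.Perm ℕ} (hw : IsFinPerm w) :
    (Schubert w).IsHomogeneous (invLen w) := by
  obtain ⟨n, hn⟩ := hw
  induction hd : n * n - invLen w using Nat.strong_induction_on generalizing w with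
  | _ d ih =>
    by_cases h : ∃ i, i + 1 < n ∧ w i < w (i + 1)
    · obtain ⟨i, hi, hlt⟩ := h
      have hsymm := hn.mul_swap (Nat.lt_of_succ_lt hi) hi
      have hlen := invLen_mul_swap_succ ⟨n, hn⟩ hlt
      have := hsymm.invLen_le
      rw [Schubert_eq_divDiff ⟨n, hn⟩ hlt]
      exact isHomogeneous_divDiff _ _ (hlen ▸ ih _ (by omega) hsymm rfl)
    · rw [Schubert_eq_schubertIn hn, schubertIn_of_not_ascent h, hn.invLen_of_not_ascent h]
      exact IsHomogeneous.prod _ _ _ fun i _ => by simpa using (isHomogeneous_X ℤ i).pow (n - 1 - i)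

/-! ### Chevalley's formula and Monk's rule -/

/-- The contribution of the transposition `t_p` to the expansion of `(∑ c_j x_j) · 𝔖_u`. -/
noncomputable def chevalleyTerm (c : ℕ →₀ ℤ) (u : Equiv.Perm ℕ) (p : ℕ × ℕ) : MvPolynomial ℕ ℤ :=
  if p.1 < p.2 ∧ invLen (u * Equiv.swap p.1 p.2) = invLen u + 1 then
    (c p.1 - c p.2) • Schubert (u * Equiv.swap p.1 p.2)
  else 0

theorem finite_support_chevalleyTerm (c : ℕ →₀ ℤ) {u : Equiv.Perm ℕ} (hu : IsFinPerm u) :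
    (Function.support (chevalleyTerm c u)).Finite := by
  obtain ⟨n, hn⟩ := hu
  obtain ⟨N, hN⟩ := c.support.exists_nat_subset_range
  have hc : ∀ j, N ≤ j → c j = 0 := fun j hj => by
    by_contra hne
    have := Finset.mem_range.1 (hN (Finsupp.mem_support_iff.2 hne))
    omega
  refine (Finset.finite_toSet (Finset.range (n + N + 1) ×ˢ Finset.range (n + N + 1))).subset ?_
  rintro ⟨a, b⟩ hp
  rw [Function.mem_support, chevalleyTerm] at hp
  obtain ⟨⟨hab, hcov⟩, hp⟩ := ite_ne_right_iff.1 hp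
  dsimp only at hab hcov hp
  have hb := hn.le_of_cover hcov
  have ha : a < N := by
    by_contra! ha
    rw [hc a ha, hc b (ha.trans hab.le)] at hp
    simp at hp
  simp only [Finset.coe_product, Finset.coe_range, Set.mem_prod, Set.mem_Iio]
  omega

theorem isHomogeneous_chevalleyTerm (c : ℕ →₀ ℤ) {u : Equiv.Perm ℕ} (hu : IsFinPerm u)
    (p : ℕ × ℕ) : (chevalleyTerm c u p).IsHomogeneous (invLen u + 1) := by
  rw [chevalleyTerm]
  split_ifs with h
  · rw [← h.2, smul_eq_C_mul]
    exact (isHomogeneous_Schubert (hu.mul_swap _ _)).C_mul _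
  · exact isHomogeneous_zero _ _ _

theorem divDiff_zsmul (i : ℕ) (a : ℤ) (f : MvPolynomial ℕ ℤ) :
    divDiff i (a • f) = a • divDiff i f :=
  map_zsmul (divDiffHom i) a f

theorem rename_linearCombination_X (σ : Equiv.Perm ℕ) (c : ℕ →₀ ℤ) :
    rename σ (Finsupp.linearCombination ℤ X c : MvPolynomial ℕ ℤ) =
      Finsupp.linearCombination ℤ X (c.mapDomain σ) := by
  rw [Finsupp.linearCombination_mapDomain]
  induction c using Finsupp.induction_linear with
  | zero => simp
  | add c d hc hd => simp only [map_add, hc, hd]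
  | single j a => simp

theorem divDiff_linearCombination_X (i : ℕ) (c : ℕ →₀ ℤ) :
    divDiff i (Finsupp.linearCombination ℤ X c) = C (c i - c (i + 1)) := by
  apply divDiff_eq_of_mul_eq
  induction c using Finsupp.induction_linear with
  | zero => simp
  | add c d hc hd =>
    simp only [map_add, Finsupp.add_apply, map_sub] at hc hd ⊢
    linear_combination hc + hd
  | single j a =>
    simp only [Finsupp.linearCombination_single, smul_eq_C_mul, map_mul, rename_C, rename_X]
    rcases eq_or_ne j i with rfl | h1
    · simp
      ring
    rcases eq_or_ne j (i + 1) with rfl | h2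
    · simp
      ring
    · simp [Equiv.swap_apply_of_ne_of_ne h1 h2, h1, h2]

theorem isHomogeneous_linearCombination_X (c : ℕ →₀ ℤ) :
    (Finsupp.linearCombination ℤ X c : MvPolynomial ℕ ℤ).IsHomogeneous 1 := by
  rw [Finsupp.linearCombination_apply]
  refine IsHomogeneous.sum _ _ _ fun j _ => ?_
  simpa only [smul_eq_C_mul] using (isHomogeneous_X ℤ j).C_mul (c j)

theorem divDiff_chevalleyTerm_of_ascent (c : ℕ →₀ ℤ) {u : Equiv.Perm ℕ} (hu : IsFinPerm u) {i : ℕ}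
    (h : u i < u (i + 1)) (p : ℕ × ℕ) : divDiff i (chevalleyTerm c u p) =
      if p = (i, i + 1) then (c i - c (i + 1)) • Schubert u else 0 := by
  obtain ⟨a, b⟩ := p
  have hfin := hu.mul_swap a b
  by_cases hcov : a < b ∧ invLen (u * Equiv.swap a b) = invLen u + 1
  · rw [chevalleyTerm, if_pos hcov, divDiff_zsmul]
    split_ifs with hp
    · obtain ⟨rfl, rfl⟩ := Prod.mk.inj hp
      rw [divDiff_Schubert_of_descent hfin (by simpa using h), mul_swap_mul_swap_self]
    · rw [divDiff_Schubert_of_ascent hfin, smul_zero]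
      by_contra! hle
      have hne : (u * Equiv.swap a b) (i + 1) ≠ (u * Equiv.swap a b) i := fun h => by
        simpa using (u * Equiv.swap a b).injective h
      obtain ⟨rfl, rfl⟩ :=
        eq_of_cover_of_ascent_of_descent hu hcov.1 hcov.2 h (lt_of_le_of_ne hle hne)
      exact hp rfl
  · rw [chevalleyTerm, if_neg hcov, if_neg]
    · exact map_zero (divDiffHom i)
    · rintro hp
      obtain ⟨rfl, rfl⟩ := Prod.mk.inj hp
      exact hcov ⟨by simp, invLen_mul_swap_succ hu h⟩

theorem divDiff_chevalleyTerm_of_descent (c : ℕ →₀ ℤ) {u : Equiv.Perm ℕ} (hu : IsFinPerm u) {i : ℕ}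
    (h : u (i + 1) < u i) (p : ℕ × ℕ) : divDiff i (chevalleyTerm c u p) =
      chevalleyTerm (c.mapDomain (Equiv.swap i (i + 1))) (u * Equiv.swap i (i + 1))
        (Equiv.swap i (i + 1) p.1, Equiv.swap i (i + 1) p.2) +
      if p = (i + 1, i) then (c i - c (i + 1)) • Schubert u else 0 := by
  obtain ⟨a, b⟩ := p
  have hfin := hu.mul_swap a b
  have hlen := invLen_mul_swap_succ_of_gt hu h
  have hzero : divDiff i 0 = 0 := map_zero (divDiffHom i)
  simp only [chevalleyTerm, Finsupp.mapDomain_equiv_apply, Equiv.symm_swap, Equiv.swap_apply_self,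
    mul_swap_mul_swap_apply, ← hlen]
  by_cases h1 : a = i ∧ b = i + 1
  · obtain ⟨rfl, rfl⟩ := h1
    have hcov : invLen (u * Equiv.swap a (a + 1)) ≠ invLen u + 1 := by omega
    simp [hzero, hcov]
  by_cases h2 : a = i + 1 ∧ b = i
  · obtain ⟨rfl, rfl⟩ := h2
    rw [Equiv.swap_comm (b + 1) b, mul_swap_mul_swap_self]
    simp [hzero]
    ring
  have hiff : Equiv.swap i (i + 1) a < Equiv.swap i (i + 1) b ↔ a < b := by
    simp only [Equiv.swap_apply_def]
    split_ifs <;> omega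
  have hp : (a, b) ≠ (i + 1, i) := fun h => h2 (Prod.mk.inj h)
  simp only [if_neg hp, add_zero, hiff]
  by_cases hab : a < b
  swap
  · simp [hab, hzero]
  have hne : (u * Equiv.swap a b) i ≠ (u * Equiv.swap a b) (i + 1) := fun h => by
    simpa using (u * Equiv.swap a b).injective h
  rcases lt_or_gt_of_ne hne with hasc | hdesc
  · have hcov : invLen (u * Equiv.swap a b * Equiv.swap i (i + 1)) ≠ invLen u := by
      intro hcov
      rw [← mul_swap_mul_swap_apply, hlen] at hcov
      obtain ⟨ha, hb⟩ := eq_of_cover_of_ascent_of_descent (hu.mul_swap i (i + 1)) (i := i)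
        (hiff.2 hab) hcov (by simpa using h) (by simpa [mul_swap_mul_swap_apply] using hasc)
      rw [Equiv.swap_apply_eq_iff] at ha hb
      exact h2 ⟨by simpa using ha, by simpa using hb⟩
    simp only [hcov, and_false, if_false]
    split_ifs
    · rw [divDiff_zsmul, divDiff_Schubert_of_ascent hfin hasc, smul_zero]
    · exact hzero
  · simp only [invLen_mul_swap_succ_of_gt hfin hdesc, Nat.add_right_cancel_iff]
    split_ifs
    · rw [divDiff_zsmul, divDiff_Schubert_of_descent hfin hdesc]
    · exact hzero

/-- Chevalley's formula: the expansion of the product of a linear form and a Schubert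
polynomial. -/
theorem linearCombination_X_mul_Schubert (c : ℕ →₀ ℤ) {u : Equiv.Perm ℕ} (hu : IsFinPerm u) :
    Finsupp.linearCombination ℤ X c * Schubert u = ∑ᶠ p, chevalleyTerm c u p := by
  induction hd : invLen u using Nat.strong_induction_on generalizing c u with
  | _ d ih =>
    rw [← sub_eq_zero]
    have hhom : (∑ᶠ p, chevalleyTerm c u p).IsHomogeneous (invLen u + 1) := by
      rw [finsum_eq_sum _ (finite_support_chevalleyTerm c hu)]
      exact IsHomogeneous.sum _ _ _ fun p _ => isHomogeneous_chevalleyTerm c hu p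
    refine eq_zero_of_divDiff_eq_zero (d := invLen u + 1) (Nat.succ_ne_zero _)
      (IsHomogeneous.sub ?_ hhom) fun i => ?_
    · rw [add_comm]
      exact (isHomogeneous_linearCombination_X c).mul (isHomogeneous_Schubert hu)
    have hsum : divDiff i (∑ᶠ p, chevalleyTerm c u p) = ∑ᶠ p, divDiff i (chevalleyTerm c u p) :=
      (divDiffHom i).map_finsum (finite_support_chevalleyTerm c hu)
    rw [← divDiffHom_apply, map_sub, divDiffHom_apply, divDiffHom_apply, sub_eq_zero, hsum,
      divDiff_mul, divDiff_linearCombination_X, rename_linearCombination_X, ← smul_eq_C_mul]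
    have hsingle : ∀ q : ℕ × ℕ, ∑ᶠ p : ℕ × ℕ,
        (if p = q then (c i - c (i + 1)) • Schubert u else 0) =
          (c i - c (i + 1)) • Schubert u := fun q => by
      rw [finsum_eq_single _ q fun p hp => if_neg hp, if_pos rfl]
    have hne : u i ≠ u (i + 1) := fun h => by simpa using u.injective h
    rcases lt_or_gt_of_ne hne with hasc | hdesc
    · simp only [divDiff_chevalleyTerm_of_ascent c hu hasc, divDiff_Schubert_of_ascent hu hasc,
        mul_zero, add_zero, hsingle]
    · have hlen := invLen_mul_swap_succ_of_gt hu hdesc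
      have hfin := hu.mul_swap i (i + 1)
      set e : ℕ × ℕ ≃ ℕ × ℕ := (Equiv.swap i (i + 1)).prodCongr (Equiv.swap i (i + 1)) with he
      set c' := c.mapDomain (Equiv.swap i (i + 1)) with hc'
      have hreindex := finsum_comp_equiv e
        (f := chevalleyTerm c' (u * Equiv.swap i (i + 1)))
      rw [divDiff_Schubert_of_descent hu hdesc, ih _ (by omega) c' hfin rfl, ← hreindex]
      simp only [divDiff_chevalleyTerm_of_descent c hu hdesc]
      rw [finsum_add_distrib, hsingle, add_comm]
      · rfl
      · exact ((finite_support_chevalleyTerm c' hfin).preimage e.injective.injOn)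
      · refine (Set.finite_singleton (i + 1, i)).subset fun p hp => ?_
        exact (ite_ne_right_iff.1 hp).1

theorem Schubert_swap_succ (k : ℕ) : Schubert (Equiv.swap k (k + 1)) =
    Finsupp.linearCombination ℤ X (Finsupp.indicator (Finset.range (k + 1)) fun _ _ => (1 : ℤ)) := by
  have h1 : IsFinPerm 1 := ⟨0, fun _ _ => rfl⟩
  have hfin : IsFinPerm (Equiv.swap k (k + 1)) := by simpa using h1.mul_swap k (k + 1)
  have hlen : invLen (Equiv.swap k (k + 1)) = 1 := by
    have := invLen_mul_swap_succ h1 (i := k) (by simp)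
    rw [one_mul] at this
    rw [this]
    have hempty : {p : ℕ × ℕ | p.1 < p.2 ∧ (1 : Equiv.Perm ℕ) p.2 < (1 : Equiv.Perm ℕ) p.1} = ∅ :=
      Set.eq_empty_of_forall_notMem fun p hp => lt_asymm hp.1 hp.2
    rw [invLen, hempty, Set.ncard_empty]
  have hhom := isHomogeneous_Schubert hfin
  rw [hlen] at hhom
  rw [← sub_eq_zero]
  refine eq_zero_of_divDiff_eq_zero one_ne_zero (hhom.sub (isHomogeneous_linearCombination_X _))
    fun i => ?_
  rw [← divDiffHom_apply, map_sub, divDiffHom_apply, divDiffHom_apply, sub_eq_zero,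
    divDiff_linearCombination_X]
  simp only [Finsupp.indicator_apply, Finset.mem_range]
  rcases eq_or_ne i k with rfl | hik
  · rw [divDiff_Schubert_of_descent hfin (by simp), Equiv.swap_mul_self, Schubert_one]
    simp
  · rw [divDiff_Schubert_of_ascent hfin]
    · split_ifs <;> first | omega | simp
    · simp only [Equiv.swap_apply_def]
      split_ifs <;> omega

/-- Monk's rule: `𝔖_u · 𝔖_{s_k} = Σ 𝔖_{u·t_{ij}}`, the sum over all pairs `i ≤ k < j`
with `u ⋖ u·t_{ij}` a cover in strong Bruhat order (the finite set `S` enumerates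
exactly these pairs). -/
theorem monk_rule
    (n : ℕ) (u : Equiv.Perm ℕ) (hu : InSymm n u) (k : ℕ) (hk : k + 1 < n)
    (S : Finset (ℕ × ℕ))
    (hS : ∀ p : ℕ × ℕ, p ∈ S ↔
      p.1 ≤ k ∧ k < p.2 ∧ invLen (u * Equiv.swap p.1 p.2) = invLen u + 1) :
    Schubert u * Schubert (Equiv.swap k (k + 1)) =
      ∑ p ∈ S, Schubert (u * Equiv.swap p.1 p.2) := by
  rw [Schubert_swap_succ, mul_comm, linearCombination_X_mul_Schubert _ ⟨n, hu⟩]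
  have hterm : ∀ p, chevalleyTerm (Finsupp.indicator (Finset.range (k + 1)) fun _ _ => (1 : ℤ)) u p =
      if p ∈ S then Schubert (u * Equiv.swap p.1 p.2) else 0 := by
    intro p
    rw [chevalleyTerm]
    simp only [hS, Finsupp.indicator_apply, Finset.mem_range]
    by_cases hcov : invLen (u * Equiv.swap p.1 p.2) = invLen u + 1
    · simp only [hcov, and_true]
      split_ifs <;> first | omega | simp
    · simp [hcov]
  simp only [hterm]
  refine (finsum_eq_sum_of_support_subset (s := S) _ fun p hp => (ite_ne_right_iff.1 hp).1).trans ?_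
  exact Finset.sum_congr rfl fun p hp => if_pos hp
end

section
/- For every w ∈ S_n and every integer N ≥ 1, code scaling preserves the descent set: Des(N∗w) = Des(w). -/
open scoped Classical

theorem finite_lCode_set (w : Equiv.Perm ℕ) (i : ℕ) : {j | i < j ∧ w j < w i}.Finite :=
  ((Set.finite_Iio (w i)).preimage w.injective.injOn).subset fun _ hj => hj.2

/-- A permutation has a descent at `i` iff its Lehmer code strictly decreases at `i`. -/
theorem mem_des_iff_lCode_lt (w : Equiv.Perm ℕ) (i : ℕ) :
    i ∈ des w ↔ lCode w (i + 1) < lCode w i := by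
  refine ⟨fun h => ?_, fun h => ?_⟩
  · have h : w (i + 1) < w i := h
    refine Set.ncard_lt_ncard ⟨fun j hj => ⟨by have := hj.1; omega, hj.2.trans h⟩, fun hs => ?_⟩
      (finite_lCode_set w i)
    exact lt_irrefl _ (hs ⟨Nat.lt_succ_self i, h⟩).1
  · by_contra hd
    have hd : w i ≤ w (i + 1) := not_lt.mp hd
    refine absurd h (not_lt.mpr (Set.ncard_le_ncard (fun j hj => ?_) (finite_lCode_set w (i + 1))))
    have hne : j ≠ i + 1 := fun e => absurd hj.2 (not_lt.mpr (e ▸ hd))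
    exact ⟨by have := hj.1; omega, hj.2.trans_le hd⟩

/-- Code scaling preserves the descent set: `Des(N∗w) = Des(w)`. -/
theorem codeScale_descents
    (n : ℕ) (w : Equiv.Perm ℕ) (hw : InSymm n w) (N : ℕ) (hN : 1 ≤ N)
    (w' : Equiv.Perm ℕ) (h : IsCodeScale N w w') :
    des w' = des w := by
  ext i
  rw [mem_des_iff_lCode_lt, mem_des_iff_lCode_lt, h.2, h.2]
  exact Nat.mul_lt_mul_left hN
end

section
/- Let w ∈ S_n have all descents at most k, and let N ≥ 1. Then bit scaling with respect to k preserves the descent set: Des(N⊗w) = Des(w). -/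
open scoped Classical

theorem ncard_lt_and_le (P : ℕ → Prop) {j j' : ℕ} (hj : j < j') :
    Set.ncard {h | h < j ∧ P h} + (if P j then 1 else 0) ≤ Set.ncard {h | h < j' ∧ P h} := by
  have hfin : ∀ a, {h | h < a ∧ P h}.Finite := fun a =>
    (Set.finite_lt_nat a).subset fun _ hx => hx.1
  split_ifs with hP
  · rw [← Set.ncard_insert_of_notMem (fun hx => lt_irrefl j hx.1) (hfin j)]
    refine Set.ncard_le_ncard ?_ (hfin j')
    rintro x (rfl | ⟨hx, hPx⟩)
    · exact ⟨hj, hP⟩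
    · exact ⟨hx.trans hj, hPx⟩
  · exact Set.ncard_le_ncard (fun x hx => ⟨hx.1.trans hj, hx.2⟩) (hfin j')

/-- The copies of column `j` end before those of any later column `j'` start. -/
theorem stretchCol_add_le (k N : ℕ) (w : Equiv.Perm ℕ) {j j' : ℕ} (hj : j < j') :
    stretchCol k N w j + (if j ∈ shadedCols k w then N else 1) ≤ stretchCol k N w j' := by
  have hu := ncard_lt_and_le (fun h => h ∉ shadedCols k w) hj
  have hs := Nat.mul_le_mul_left N (ncard_lt_and_le (fun h => h ∈ shadedCols k w) hj)
  rw [mul_add] at hs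
  unfold stretchCol
  by_cases hm : j ∈ shadedCols k w <;> simp [hm] at hu hs ⊢ <;> omega

/-- Copies of distinct columns occupy distinct positions. -/
theorem stretchCol_add_inj (k N : ℕ) (w : Equiv.Perm ℕ) {j j' m m' : ℕ}
    (hm : m < if j ∈ shadedCols k w then N else 1)
    (hm' : m' < if j' ∈ shadedCols k w then N else 1)
    (h : stretchCol k N w j + m = stretchCol k N w j' + m') : j = j' := by
  rcases lt_trichotomy j j' with hj | hj | hj
  · have := stretchCol_add_le k N w hj
    omega
  · exact hj
  · have := stretchCol_add_le k N w hj
    omega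

/-- `i` is a descent iff some column of the Rothe diagram contains `i` but not `i + 1`. -/
theorem mem_des_iff_rothe (w : Equiv.Perm ℕ) (i : ℕ) :
    i ∈ des w ↔ ∃ h, (i, h) ∈ rothe w ∧ (i + 1, h) ∉ rothe w := by
  simp only [des, rothe, Set.mem_ofPred_eq]
  constructor
  · intro hi
    exact ⟨w (i + 1), by simpa using hi, by simp⟩
  · rintro ⟨h, ⟨h1, h2⟩, h3⟩
    by_cases hc : h < w (i + 1)
    · have hsymm : w.symm h = i + 1 := by
        by_contra hne
        exact h3 ⟨hc, by omega⟩
      rw [Equiv.symm_apply_eq] at hsymm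
      omega
    · omega

/-- Bit scaling preserves the descent set: `Des(N⊗w) = Des(w)`. -/
theorem bitScale_descents
    (n : ℕ) (w : Equiv.Perm ℕ) (hw : InSymm n w) (k : ℕ)
    (hk : ∀ e ∈ des w, e ≤ k) (N : ℕ) (hN : 1 ≤ N)
    (w' : Equiv.Perm ℕ) (h : IsBitScale k N w w') :
    des w' = des w := by
  have hpos : ∀ j, 0 < if j ∈ shadedCols k w then N else 1 := fun j => by split_ifs <;> omega
  ext i
  rw [mem_des_iff_rothe, mem_des_iff_rothe, h.2]
  constructor
  · rintro ⟨_, ⟨⟨_, j⟩, hp, m, hm, ⟨⟩⟩, hnot⟩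
    exact ⟨j, hp, fun hj => hnot ⟨_, hj, m, hm, rfl⟩⟩
  · rintro ⟨j, hj, hnot⟩
    refine ⟨stretchCol k N w j, ⟨_, hj, 0, hpos j, rfl⟩, ?_⟩
    rintro ⟨⟨r, j'⟩, hp, m, hm, heq⟩
    obtain ⟨rfl, he⟩ := Prod.mk.inj heq
    obtain rfl := stretchCol_add_inj k N w (hpos j) hm he
    exact hnot hp
end
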